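/- arXiv:1811.05174 — 4 statements merged into one kernel-verified Lean document; each statement's English description precedes it below -/
import Mathlib

section
/- For every non-decreasing function δ: (0,1) → (0,1) there exist a two-valent symbol φ with φ(D) = D ∖ {0} (a 'nearly surjective' symbol) and a number h₀ ∈ (0,1) such that m({z ∈ T : |φ*(z)| ≥ 1 − h}) ≤ δ(h) for all 0 < h ≤ h₀. -/
open Complex MeasureTheory Set Filter
open scoped ENNReal Topology

noncomputable section

/-- The open unit disk in `ℂ`. -/
def unitDisk : Set ℂ := Metric.ball (0 : ℂ) 1

/-- A symbol: a non-constant analytic self-map of the unit disk. -/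
structure IsSymbol (φ : ℂ → ℂ) : Prop where
  mapsTo : Set.MapsTo φ unitDisk unitDisk
  diff : DifferentiableOn ℂ φ unitDisk
  nonconst : ¬ ∃ c : ℂ, Set.EqOn φ (fun _ => c) unitDisk

/-- `φ` is `p`-valent: every `w ∈ 𝔻` has at most `p` preimages in `𝔻`. -/
def Valent (φ : ℂ → ℂ) (p : ℕ) : Prop :=
  ∀ w ∈ unitDisk, (unitDisk ∩ φ ⁻¹' {w}).encard ≤ p

/-- The radial limit of `φ` at the boundary point `toCircle θ` exists and equals `w`.
The circle `𝕋` is parametrized by `AddCircle 1` (so that `volume` is the normalized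
Haar measure `m`). -/
def HasRadialLimit (φ : ℂ → ℂ) (θ : AddCircle (1 : ℝ)) (w : ℂ) : Prop :=
  Filter.Tendsto (fun r : ℝ => φ (r * (AddCircle.toCircle θ : ℂ)))
    (nhdsWithin 1 (Set.Iio 1)) (nhds w)

/-- The pull-back measure `m_φ(S) = m({ξ : φ*(ξ) ∈ S})`. -/
def pullbackMeasure (φ : ℂ → ℂ) (S : Set ℂ) : ℝ≥0∞ :=
  volume {θ : AddCircle (1 : ℝ) | ∃ w ∈ S, HasRadialLimit φ θ w}

/-- `ρ_φ(h) = sup_{ξ ∈ 𝕋} m_φ[S(ξ,h)]`, where `S(ξ,h) = {z : |z - ξ| ≤ h}`. -/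
def rho (φ : ℂ → ℂ) (h : ℝ) : ℝ≥0∞ :=
  ⨆ ξ : Circle, pullbackMeasure φ {z : ℂ | ‖z - (ξ : ℂ)‖ ≤ h}

/-- The `n`-th approximation number of a bounded operator between normed spaces:
the distance of `T` to operators of rank `< n`. -/
def approxNum {E F : Type*} [NormedAddCommGroup E] [NormedAddCommGroup F]
    [NormedSpace ℂ E] [NormedSpace ℂ F] (n : ℕ) (T : E →L[ℂ] F) : ℝ :=
  sInf {c : ℝ | ∃ R : E →L[ℂ] F,
    Module.rank ℂ (LinearMap.range (R : E →ₗ[ℂ] F)) < (n : Cardinal) ∧ c = ‖T - R‖}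

/-- The Hardy space `H²(𝔻)` in its coefficient model `ℓ²(ℕ)`. -/
abbrev H2 := lp (fun _ : ℕ => ℂ) 2

/-- The analytic function on `𝔻` associated with an element of `H²`. -/
def H2.eval (a : H2) (z : ℂ) : ℂ := ∑' n : ℕ, a n * z ^ n

/-- `T` is the composition operator with symbol `φ` on `H²(𝔻)`. -/
def IsCompOp (φ : ℂ → ℂ) (T : H2 →L[ℂ] H2) : Prop :=
  ∀ a : H2, ∀ z ∈ unitDisk, H2.eval (T a) z = H2.eval a (φ z)

/-- The open unit polydisk `𝔻^N`. -/
def polyDisk (N : ℕ) : Set (Fin N → ℂ) := {z | ∀ i, ‖z i‖ < 1}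

/-- The Hardy space `H²(𝔻^N)` in its coefficient model `ℓ²(ℕ^N)`. -/
abbrev H2poly (N : ℕ) := lp (fun _ : Fin N → ℕ => ℂ) 2

/-- The analytic function on `𝔻^N` associated with an element of `H²(𝔻^N)`. -/
def H2poly.eval {N : ℕ} (a : H2poly N) (z : Fin N → ℂ) : ℂ :=
  ∑' α : Fin N → ℕ, a α * ∏ i, z i ^ α i

/-- `T` is the composition operator with symbol `Φ` on `H²(𝔻^N)`. -/
def IsCompOpPoly {N : ℕ} (Φ : (Fin N → ℂ) → (Fin N → ℂ))
    (T : H2poly N →L[ℂ] H2poly N) : Prop :=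
  ∀ a : H2poly N, ∀ z ∈ polyDisk N, H2poly.eval (T a) z = H2poly.eval a (Φ z)

/-- The lens map `λ_θ`. -/
def lens (θ : ℝ) (z : ℂ) : ℂ :=
  ((1 + z) ^ (θ : ℂ) - (1 - z) ^ (θ : ℂ)) / ((1 + z) ^ (θ : ℂ) + (1 - z) ^ (θ : ℂ))


/-- **Montel's theorem**, ultrafilter version. -/
theorem exists_tendstoLocallyUniformlyOn_of_norm_le_one {U : Set ℂ} (hU : IsOpen U)
    {F : ℕ → ℂ → ℂ} (hF : ∀ n, DifferentiableOn ℂ (F n) U)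
    (hb : ∀ n, ∀ z ∈ U, ‖F n z‖ ≤ 1) (u : Ultrafilter ℕ) :
    ∃ f : ℂ → ℂ, TendstoLocallyUniformlyOn F f u U := by
  have hlim : ∀ z ∈ U, ∃ y : ℂ, Tendsto (fun n => F n z) u (𝓝 y) := fun z hz => by
    obtain ⟨y, -, hy⟩ := (isCompact_closedBall (0 : ℂ) 1).ultrafilter_le_nhds
      (u.map fun n => F n z) (by
        rw [le_principal_iff]
        exact Ultrafilter.mem_map.2 (Filter.univ_mem' fun n => mem_closedBall_zero_iff.2 (hb n z hz)))
    exact ⟨y, hy⟩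
  choose! f hf using hlim
  refine ⟨f, Metric.tendstoLocallyUniformlyOn_iff.2 fun ε hε z₀ hz₀ => ?_⟩
  obtain ⟨R, hR, hRU⟩ := Metric.isOpen_iff.1 hU z₀ hz₀
  have hlip : ∀ n, ∀ z ∈ Metric.ball z₀ R, dist (F n z) (F n z₀) ≤ 2 / R * dist z z₀ := by
    intro n z hz
    refine dist_le_div_mul_dist_of_mapsTo_ball ((hF n).mono hRU) (fun w hw => ?_) hz
    rw [Metric.mem_closedBall, dist_eq_norm]
    linarith [norm_sub_le (F n w) (F n z₀), hb n w (hRU hw), hb n z₀ hz₀]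
  have hlipf : ∀ z ∈ Metric.ball z₀ R, dist (f z) (f z₀) ≤ 2 / R * dist z z₀ := fun z hz =>
    le_of_tendsto ((hf z (hRU hz)).dist (hf z₀ hz₀)) (.of_forall fun n => hlip n z hz)
  refine ⟨Metric.ball z₀ (min R (ε * R / 8)),
    mem_nhdsWithin_of_mem_nhds (Metric.ball_mem_nhds _ (by positivity)), ?_⟩
  filter_upwards [Metric.tendsto_nhds.1 (hf z₀ hz₀) (ε / 3) (by positivity)] with n hn z hz
  have hz' := lt_min_iff.1 (Metric.mem_ball.1 hz)
  have h1 := hlip n z hz'.1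
  have h2 := hlipf z hz'.1
  have h3 : 2 / R * dist z z₀ ≤ ε / 4 := by
    calc 2 / R * dist z z₀ ≤ 2 / R * (ε * R / 8) := by gcongr; exact hz'.2.le
      _ = ε / 4 := by field_simp; norm_num
  have h4 := dist_triangle4 (f z) (f z₀) (F n z₀) (F n z)
  rw [dist_comm (f z₀), dist_comm (F n z₀) (F n z)] at h4
  linarith

/-- **Hurwitz's theorem**: if a locally uniform limit of nonvanishing holomorphic functions vanishes
at a point, then it vanishes near this point. -/
theorem eventually_eq_zero_of_tendstoLocallyUniformlyOn {ι : Type*} {p : Filter ι} [p.NeBot]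
    {U : Set ℂ} (hU : IsOpen U) {F : ι → ℂ → ℂ} {f : ℂ → ℂ} (hf : TendstoLocallyUniformlyOn F f p U)
    (hF : ∀ n, DifferentiableOn ℂ (F n) U) (hF0 : ∀ n, ∀ z ∈ U, F n z ≠ 0)
    {z₀ : ℂ} (hz₀ : z₀ ∈ U) (hfz : f z₀ = 0) : ∀ᶠ z in 𝓝 z₀, f z = 0 := by
  have hfd : DifferentiableOn ℂ f U := hf.differentiableOn (.of_forall hF) hU
  refine ((hfd.analyticAt (hU.mem_nhds hz₀)).eventually_eq_zero_or_eventually_ne_zero).resolve_right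
    fun hne => ?_
  rw [eventually_nhdsWithin_iff] at hne
  obtain ⟨r, hr, hball⟩ := Metric.nhds_basis_closedBall.mem_iff.1
    (inter_mem (hU.mem_nhds hz₀) hne)
  have hrU : Metric.closedBall z₀ r ⊆ U := fun z hz => (hball hz).1
  obtain ⟨w, hw, hmin⟩ := (isCompact_sphere z₀ r).exists_isMinOn
    (NormedSpace.sphere_nonempty.2 hr.le)
    ((hfd.continuousOn.mono (Metric.sphere_subset_closedBall.trans hrU)).norm)
  have hm : 0 < ‖f w‖ := norm_pos_iff.2
    ((hball (Metric.sphere_subset_closedBall hw)).2 (Metric.ne_of_mem_sphere hw hr.ne'))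
  have hunif := Metric.tendstoUniformlyOn_iff.1
    ((tendstoLocallyUniformlyOn_iff_forall_isCompact hU).1 hf _ hrU (isCompact_closedBall z₀ r))
    (‖f w‖ / 2) (by positivity)
  obtain ⟨n, hn⟩ := hunif.exists
  have h0 := hn z₀ (Metric.mem_closedBall_self hr.le)
  rw [hfz, dist_zero_left] at h0
  have hinv : DifferentiableOn ℂ (fun z => (F n z)⁻¹) U := (hF n).inv (hF0 n)
  have hmax : ‖(F n z₀)⁻¹‖ ≤ (‖f w‖ / 2)⁻¹ := by
    refine norm_le_of_forall_mem_frontier_norm_le (U := Metric.ball z₀ r) Metric.isBounded_ball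
      (hinv.mono (closure_ball z₀ hr.ne' ▸ hrU)).diffContOnCl (fun z hz => ?_)
      (subset_closure (Metric.mem_ball_self hr))
    rw [frontier_ball z₀ hr.ne'] at hz
    have h1 := hn z (Metric.sphere_subset_closedBall hz)
    have h2 : ‖f w‖ ≤ ‖f z‖ := hmin hz
    rw [dist_eq_norm] at h1
    rw [norm_inv]
    gcongr
    linarith [norm_sub_norm_le (f z) (F n z)]
  rw [norm_inv, inv_le_inv₀ (norm_pos_iff.2 (hF0 n z₀ hz₀)) (by positivity)] at hmax
  linarith

/-- The Blaschke factor `ζ ↦ (ζ - w) / (1 - conj w * ζ)`. -/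
def blaschke (w ζ : ℂ) : ℂ := (ζ - w) / (1 - (starRingEnd ℂ) w * ζ)

theorem one_sub_conj_mul_ne_zero {w ζ : ℂ} (hw : ‖w‖ < 1) (hζ : ‖ζ‖ < 1) :
    1 - (starRingEnd ℂ) w * ζ ≠ 0 := by
  intro h
  have h1 : ‖(starRingEnd ℂ) w * ζ‖ = 1 := by rw [← sub_eq_zero.1 h, norm_one]
  rw [norm_mul, RCLike.norm_conj] at h1
  nlinarith [norm_nonneg w, norm_nonneg ζ]

theorem norm_blaschke_lt_one {w ζ : ℂ} (hw : ‖w‖ < 1) (hζ : ‖ζ‖ < 1) : ‖blaschke w ζ‖ < 1 := by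
  have h0 := one_sub_conj_mul_ne_zero hw hζ
  rw [blaschke, norm_div, div_lt_one (norm_pos_iff.2 h0), ← sq_lt_sq₀ (norm_nonneg _) (norm_nonneg _)]
  rw [← sq_lt_sq₀ (norm_nonneg _) zero_le_one] at hw hζ
  simp only [← normSq_eq_norm_sq, normSq_apply] at *
  simp
  nlinarith

theorem blaschke_injOn {w : ℂ} (hw : ‖w‖ < 1) : InjOn (blaschke w) (Metric.ball 0 1) := by
  intro x hx y hy h
  rw [mem_ball_zero_iff] at hx hy
  have h1 := one_sub_conj_mul_ne_zero hw hx
  have h2 := one_sub_conj_mul_ne_zero hw hy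
  have h3 := one_sub_conj_mul_ne_zero hw hw
  rw [blaschke, blaschke, div_eq_div_iff h1 h2] at h
  have : (x - y) * (1 - (starRingEnd ℂ) w * w) = 0 := by linear_combination h
  exact sub_eq_zero.1 ((mul_eq_zero.1 this).resolve_right h3)

theorem hasDerivAt_blaschke {w ζ : ℂ} (hw : ‖w‖ < 1) (hζ : ‖ζ‖ < 1) :
    HasDerivAt (blaschke w)
      ((1 - (starRingEnd ℂ) w * w) / (1 - (starRingEnd ℂ) w * ζ) ^ 2) ζ := by
  have h0 := one_sub_conj_mul_ne_zero hw hζ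
  convert! ((hasDerivAt_id ζ).sub_const w).fun_div
    (((hasDerivAt_id ζ).const_mul ((starRingEnd ℂ) w)).const_sub 1) h0 using 1
  simp only [id]
  congr 1
  ring

/-- Injective holomorphic maps from `U` to the unit disk, with nonvanishing derivative. -/
structure IsDiskEmbedding (U : Set ℂ) (f : ℂ → ℂ) : Prop where
  mapsTo : MapsTo f U (Metric.ball 0 1)
  injOn : InjOn f U
  deriv_ne : ∀ z ∈ U, deriv f z ≠ 0

namespace IsDiskEmbedding

variable {U : Set ℂ} {f : ℂ → ℂ}

theorem differentiableAt (hf : IsDiskEmbedding U f) {z : ℂ} (hz : z ∈ U) : DifferentiableAt ℂ f z :=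
  differentiableAt_of_deriv_ne_zero (hf.deriv_ne z hz)

theorem differentiableOn (hf : IsDiskEmbedding U f) : DifferentiableOn ℂ f U :=
  fun _ hz => (hf.differentiableAt hz).differentiableWithinAt

theorem norm_lt_one (hf : IsDiskEmbedding U f) {z : ℂ} (hz : z ∈ U) : ‖f z‖ < 1 :=
  mem_ball_zero_iff.1 (hf.mapsTo hz)

theorem deriv_blaschke_comp (hf : IsDiskEmbedding U f) {w : ℂ} (hw : ‖w‖ < 1) {z : ℂ} (hz : z ∈ U) :
    deriv (blaschke w ∘ f) z =
      (1 - (starRingEnd ℂ) w * w) / (1 - (starRingEnd ℂ) w * f z) ^ 2 * deriv f z :=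
  ((hasDerivAt_blaschke hw (hf.norm_lt_one hz)).comp z (hf.differentiableAt hz).hasDerivAt).deriv

theorem blaschke_comp (hf : IsDiskEmbedding U f) {w : ℂ} (hw : ‖w‖ < 1) :
    IsDiskEmbedding U (blaschke w ∘ f) where
  mapsTo z hz := mem_ball_zero_iff.2 (norm_blaschke_lt_one hw (hf.norm_lt_one hz))
  injOn := (blaschke_injOn hw).comp hf.injOn hf.mapsTo
  deriv_ne z hz := by
    rw [hf.deriv_blaschke_comp hw hz]
    exact mul_ne_zero (div_ne_zero (one_sub_conj_mul_ne_zero hw hw)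
      (pow_ne_zero _ (one_sub_conj_mul_ne_zero hw (hf.norm_lt_one hz)))) (hf.deriv_ne z hz)

/-- The square root of a nonvanishing disk embedding of a simply connected domain. -/
theorem exists_sq_eq (hf : IsDiskEmbedding U f) (hU : IsOpen U) (hUc : IsSimplyConnected U)
    (h0 : ∀ z ∈ U, f z ≠ 0) :
    ∃ h : ℂ → ℂ, IsDiskEmbedding U h ∧ ∀ z ∈ U, h z ^ 2 = f z ∧ 2 * h z * deriv h z = deriv f z := by
  obtain ⟨h, hc, hsq⟩ := exists_continuousOn_pow_eq hUc hU hf.differentiableOn.continuousOn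
    (by rintro ⟨z, hz, h⟩; exact h0 z hz h) two_ne_zero
  have hne : ∀ z ∈ U, h z ≠ 0 := fun z hz hz0 => h0 z hz (by rw [← hsq z, hz0]; simp)
  have hd : ∀ z ∈ U, HasDerivAt h (deriv f z / (2 * h z)) z := by
    intro z hz
    have hcz : ContinuousAt h z := hc.continuousAt (hU.mem_nhds hz)
    have hsum : ContinuousAt (fun x => h x + h z) z := hcz.add continuousAt_const
    have hz2 : h z + h z ≠ 0 := by rw [← two_mul]; exact mul_ne_zero two_ne_zero (hne z hz)
    rw [hasDerivAt_iff_tendsto_slope, two_mul]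
    refine ((hasDerivAt_iff_tendsto_slope.1 (hf.differentiableAt hz).hasDerivAt).div
      (hsum.tendsto.mono_left nhdsWithin_le_nhds) hz2).congr' ?_
    filter_upwards [(hsum.eventually_ne hz2).filter_mono nhdsWithin_le_nhds] with x hx
    simp only [Pi.div_apply, slope_def_field, ← hsq]
    field_simp
    ring
  have hder : ∀ z ∈ U, 2 * h z * deriv h z = deriv f z := fun z hz => by
    rw [(hd z hz).deriv, mul_div_cancel₀ _ (mul_ne_zero two_ne_zero (hne z hz))]
  refine ⟨h, ⟨fun z hz => ?_, fun x hx y hy hxy => hf.injOn hx hy ?_, fun z hz h' => ?_⟩,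
    fun z hz => ⟨hsq z, hder z hz⟩⟩
  · rw [mem_ball_zero_iff, ← pow_lt_one_iff_of_nonneg (norm_nonneg _) two_ne_zero, ← norm_pow, hsq]
    exact hf.norm_lt_one hz
  · rw [← hsq x, ← hsq y, hxy]
  · exact hf.deriv_ne z hz (by rw [← hder z hz, h', mul_zero])

/-- A disk embedding which is not onto does not have the largest possible derivative. -/
theorem exists_norm_deriv_lt (hf : IsDiskEmbedding U f) (hU : IsOpen U) (hUc : IsSimplyConnected U)
    {a w : ℂ} (ha : a ∈ U) (hfa : f a = 0) (hw : ‖w‖ < 1) (hwf : w ∉ f '' U) :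
    ∃ F : ℂ → ℂ, IsDiskEmbedding U F ∧ F a = 0 ∧ ‖deriv f a‖ < ‖deriv F a‖ := by
  have hb := hf.blaschke_comp hw
  obtain ⟨h, hh, hsq⟩ := hb.exists_sq_eq hU hUc fun z hz h0 => by
    refine hwf ⟨z, hz, ?_⟩
    rw [Function.comp_apply, blaschke, div_eq_zero_iff] at h0
    exact sub_eq_zero.1 (h0.resolve_right (one_sub_conj_mul_ne_zero hw (hf.norm_lt_one hz)))
  refine ⟨blaschke (h a) ∘ h, hh.blaschke_comp (hh.norm_lt_one ha), by simp [blaschke], ?_⟩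
  have hw0 : w ≠ 0 := by rintro rfl; exact hwf ⟨a, ha, hfa⟩
  obtain ⟨h1, h2⟩ := hsq a ha
  have h1n : ‖h a‖ ^ 2 = ‖w‖ := by rw [← norm_pow, h1]; simp [blaschke, hfa]
  have hc : ∀ v : ℂ, ‖v‖ < 1 → ‖1 - (starRingEnd ℂ) v * v‖ = 1 - ‖v‖ ^ 2 := fun v hv => by
    rw [conj_mul', ← ofReal_pow, ← ofReal_one, ← ofReal_sub, norm_real, Real.norm_of_nonneg]
    nlinarith [norm_nonneg v]
  have h2n : 2 * ‖h a‖ * ‖deriv h a‖ = (1 - ‖w‖ ^ 2) * ‖deriv f a‖ := by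
    have := congrArg norm h2
    rw [hf.deriv_blaschke_comp hw ha, hfa] at this
    simpa [hc w hw] using this
  rw [hh.deriv_blaschke_comp (hh.norm_lt_one ha) ha, norm_mul, norm_div, norm_pow,
    hc _ (hh.norm_lt_one ha)]
  have hs0 : 0 < ‖h a‖ := by
    rw [norm_pos_iff]; rintro h0; rw [h0] at h1n; simp [eq_comm, hw0] at h1n
  have hs1 : ‖h a‖ < 1 := hh.norm_lt_one ha
  have hf0 : 0 < ‖deriv f a‖ := norm_pos_iff.2 (hf.deriv_ne a ha)
  rw [← h1n] at h2n
  generalize ‖h a‖ = s at *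
  have hsd : 0 < 1 - s ^ 2 := by nlinarith
  have hd : ‖deriv h a‖ = (1 - (s ^ 2) ^ 2) * ‖deriv f a‖ / (2 * s) := by
    rw [← h2n]; field_simp
  rw [hd, pow_two (1 - s ^ 2), div_mul_cancel_left₀ hsd.ne', ← div_eq_inv_mul, div_div,
    lt_div_iff₀ (by positivity)]
  have : 0 < ‖deriv f a‖ * ((1 - s ^ 2) * (1 - s) ^ 2) := by
    have : 0 < 1 - s := by linarith
    positivity
  linarith

end IsDiskEmbedding

/-- The extremal problem of the Riemann mapping theorem has a solution. -/
theorem exists_isDiskEmbedding_norm_deriv_max {U : Set ℂ} (hU : IsOpen U) (hUc : IsPreconnected U)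
    {a : ℂ} (ha : a ∈ U) (hne : ∃ f, IsDiskEmbedding U f ∧ f a = 0) :
    ∃ f, IsDiskEmbedding U f ∧ f a = 0 ∧
      ∀ F, IsDiskEmbedding U F → F a = 0 → ‖deriv F a‖ ≤ ‖deriv f a‖ := by
  set S : Set ℝ := {x | ∃ f, (IsDiskEmbedding U f ∧ f a = 0) ∧ ‖deriv f a‖ = x} with hS
  obtain ⟨f₀, hf₀, hf₀a⟩ := hne
  obtain ⟨R, hR, hRU⟩ := Metric.isOpen_iff.1 hU a ha
  have hbdd : BddAbove S := by
    refine ⟨1 / R, ?_⟩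
    rintro _ ⟨f, ⟨hf, hfa⟩, rfl⟩
    refine norm_deriv_le_div_of_mapsTo_ball (hf.differentiableOn.mono hRU) (fun z hz => ?_) hR
    rw [hfa]
    exact Metric.ball_subset_closedBall (hf.mapsTo (hRU hz))
  obtain ⟨x, -, hx, hxS⟩ := exists_seq_tendsto_sSup
    (show S.Nonempty from ⟨_, f₀, ⟨hf₀, hf₀a⟩, rfl⟩) hbdd
  choose F hF hFx using hxS
  set u := hyperfilter ℕ
  obtain ⟨f, hf⟩ := exists_tendstoLocallyUniformlyOn_of_norm_le_one hU
    (fun n => (hF n).1.differentiableOn) (fun n z hz => ((hF n).1.norm_lt_one hz).le) u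
  have hFd : ∀ᶠ n in (u : Filter ℕ), DifferentiableOn ℂ (F n) U :=
    .of_forall fun n => (hF n).1.differentiableOn
  have hfd : DifferentiableOn ℂ f U := hf.differentiableOn hFd hU
  have hfan : AnalyticOnNhd ℂ f U := hfd.analyticOnNhd hU
  have hfa : f a = 0 := tendsto_nhds_unique (hf.tendsto_at ha) (by simp [(hF _).2])
  have hder := hf.deriv hFd hU
  have hsup : ‖deriv f a‖ = sSup S := by
    refine tendsto_nhds_unique (hder.tendsto_at ha).norm ?_
    simp only [Function.comp_apply, hFx]
    exact hx.mono_left Nat.hyperfilter_le_atTop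
  have hmax : ∀ F, IsDiskEmbedding U F → F a = 0 → ‖deriv F a‖ ≤ ‖deriv f a‖ :=
    fun F hF hFa => hsup ▸ le_csSup hbdd ⟨F, ⟨hF, hFa⟩, rfl⟩
  have hpos : deriv f a ≠ 0 := norm_pos_iff.1
    ((norm_pos_iff.2 (hf₀.deriv_ne a ha)).trans_le (hmax f₀ hf₀ hf₀a))
  have hnc : ∀ c : ℂ, ¬ EqOn f (fun _ => c) U := fun c hc => hpos <| by
    rw [(hc.eventuallyEq_of_mem (hU.mem_nhds ha)).deriv_eq, deriv_const]
  refine ⟨f, ⟨fun z hz => ?_, fun z₁ hz₁ z₂ hz₂ h12 => ?_, fun z hz hz0 => ?_⟩, hfa, hmax⟩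
  · have hsub : f '' U ⊆ Metric.closedBall 0 1 := by
      rintro _ ⟨y, hy, rfl⟩
      exact mem_closedBall_zero_iff.2
        (le_of_tendsto (hf.tendsto_at hy).norm (.of_forall fun n => ((hF n).1.norm_lt_one hy).le))
    have hop := ((hfan.is_constant_or_isOpen hUc).resolve_left
      (fun ⟨c, hc⟩ => hnc c hc)) U subset_rfl hU
    rw [← interior_closedBall (0 : ℂ) one_ne_zero]
    exact interior_maximal hsub hop (mem_image_of_mem f hz)
  · by_contra hz
    have hV : IsOpen (U \ {z₂}) := hU.sdiff isClosed_singleton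
    have hconv : TendstoLocallyUniformlyOn (fun n z => F n z - F n z₂) (fun z => f z - f z₂) u
        (U \ {z₂}) :=
      (hf.mono sdiff_subset).sub
        ((hf.tendsto_at hz₂).tendstoUniformlyOn_const _).tendstoLocallyUniformlyOn
    have := eventually_eq_zero_of_tendstoLocallyUniformlyOn hV hconv
      (fun n => ((hF n).1.differentiableOn.mono sdiff_subset).sub_const _)
      (fun n z hz h => hz.2 ((hF n).1.injOn hz.1 hz₂ (sub_eq_zero.1 h))) ⟨hz₁, hz⟩
      (sub_eq_zero.2 h12)
    exact hnc (f z₂) (hfan.eqOn_of_preconnected_of_eventuallyEq analyticOnNhd_const hUc hz₁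
      (this.mono fun z hz => sub_eq_zero.1 hz))
  · have := eventually_eq_zero_of_tendstoLocallyUniformlyOn hU hder
      (fun n => (hF n).1.differentiableOn.deriv hU) (fun n => (hF n).1.deriv_ne) hz hz0
    exact hpos (hfan.deriv.eqOn_zero_of_preconnected_of_eventuallyEq_zero hUc hz this ha)

/-- **Riemann mapping theorem**: a simply connected domain that embeds into the unit disk is the
bijective holomorphic image of the unit disk. -/
theorem exists_bijOn_ball_of_isSimplyConnected {U : Set ℂ} (hU : IsOpen U)
    (hUc : IsSimplyConnected U) (hne : ∃ f, IsDiskEmbedding U f) :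
    ∃ g : ℂ → ℂ, DifferentiableOn ℂ g (Metric.ball 0 1) ∧ BijOn g (Metric.ball 0 1) U := by
  obtain ⟨a, ha⟩ := hUc.nonempty
  obtain ⟨f₀, hf₀⟩ := hne
  obtain ⟨f, hf, hfa, hmax⟩ := exists_isDiskEmbedding_norm_deriv_max hU
    hUc.isPathConnected.isConnected.isPreconnected ha
    ⟨_, hf₀.blaschke_comp (hf₀.norm_lt_one ha), by simp [blaschke]⟩
  have hsurj : SurjOn f U (Metric.ball 0 1) := fun w hw => by
    by_contra hwf
    obtain ⟨F, hF, hFa, hlt⟩ := hf.exists_norm_deriv_lt hU hUc ha hfa (mem_ball_zero_iff.1 hw) hwf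
    exact (hmax F hF hFa).not_gt hlt
  have hbij : BijOn f U (Metric.ball 0 1) := ⟨hf.mapsTo, hf.injOn, hsurj⟩
  set g := Function.invFunOn f U
  have hinv : InvOn g f U (Metric.ball 0 1) := hbij.invOn_invFunOn
  have hg : BijOn g (Metric.ball 0 1) U := hbij.symm hinv.symm
  refine ⟨g, fun w hw => ?_, hg⟩
  have hgw := hg.mapsTo hw
  have hstrict : HasStrictDerivAt f (deriv f (g w)) (g w) :=
    (hf.differentiableOn.analyticAt (hU.mem_nhds hgw)).hasStrictDerivAt
  have hcont : ContinuousAt g w := by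
    intro V hV
    have := hstrict.map_nhds_eq (hf.deriv_ne _ hgw)
    rw [hinv.2 hw] at this
    have hmem : f '' (V ∩ U) ∈ 𝓝 w := this ▸ image_mem_map (inter_mem hV (hU.mem_nhds hgw))
    refine mem_map.2 (mem_of_superset hmem ?_)
    rintro _ ⟨z, ⟨hzV, hzU⟩, rfl⟩
    rwa [mem_preimage, hinv.1 hzU]
  refine (HasDerivAt.of_local_left_inverse hcont hstrict.hasDerivAt (hf.deriv_ne _ hgw)
    ?_).differentiableAt.differentiableWithinAt
  filter_upwards [Metric.isOpen_ball.mem_nhds hw] with y hy using hinv.2 hy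

theorem exists_isDiskEmbedding_of_re_pos {U : Set ℂ} (hU : ∀ z ∈ U, 0 < z.re) :
    ∃ f, IsDiskEmbedding U f := by
  have hne : ∀ z ∈ U, z + 1 ≠ 0 := fun z hz h => by
    have := congrArg re h
    simp at this
    linarith [hU z hz]
  refine ⟨fun z => (z - 1) / (z + 1), fun z hz => ?_, fun x hx y hy hxy => ?_, fun z hz => ?_⟩
  · rw [mem_ball_zero_iff, norm_div, div_lt_one (norm_pos_iff.2 (hne z hz)),
      ← sq_lt_sq₀ (norm_nonneg _) (norm_nonneg _), ← normSq_eq_norm_sq, ← normSq_eq_norm_sq,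
      normSq_apply, normSq_apply]
    simp
    nlinarith [hU z hz]
  · rw [div_eq_div_iff (hne x hx) (hne y hy)] at hxy
    linear_combination hxy / 2
  · have hd := ((hasDerivAt_id' z).sub_const 1).fun_div ((hasDerivAt_id' z).add_const 1) (hne z hz)
    rw [hd.deriv]
    refine div_ne_zero ?_ (pow_ne_zero _ (hne z hz))
    ring_nf
    norm_num

/-- A function that is antitone on `(0, 1)` has a majorant that is continuous on `(0, ∞)`. -/
theorem exists_continuousOn_ge_of_antitoneOn {G : ℝ → ℝ} (hG : AntitoneOn G (Ioo 0 1)) :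
    ∃ ψ : ℝ → ℝ, ContinuousOn ψ (Ioi 0) ∧ ∀ x ∈ Ioo (0 : ℝ) 1, G x ≤ ψ x := by
  obtain ⟨g, hg⟩ := exists_continuous_forall_mem_convex_of_local_const (X := Ioi (0 : ℝ)) (E := ℝ)
    (t := fun x => {v | (x : ℝ) < 1 → G x ≤ v})
    (fun x => by
      by_cases hx : (x : ℝ) < 1
      · simp only [hx, true_imp_iff]
        exact convex_Ici (G x)
      · simpa [hx] using convex_univ)
    (fun x => by
      have hx : 0 < min (x : ℝ) 1 / 2 := half_pos (lt_min x.2 one_pos)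
      refine ⟨G (min (x : ℝ) 1 / 2), ?_⟩
      have hlt : min (x : ℝ) 1 / 2 < x := by
        have : (0 : ℝ) < x := x.2
        linarith [min_le_left (x : ℝ) 1]
      filter_upwards [continuous_subtype_val.continuousAt.eventually_const_lt hlt] with y hy hy1
      exact hG ⟨hx, hy.trans hy1⟩ ⟨y.2, hy1⟩ hy.le)
  refine ⟨fun x => if hx : x ∈ Ioi (0 : ℝ) then g ⟨x, hx⟩ else 0, ?_, fun x hx => ?_⟩
  · rw [continuousOn_iff_continuous_domRestrict]
    convert g.continuous using 1
    ext x
    simp [show (0 : ℝ) < x from x.2]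
  · simpa [hx.1] using hg ⟨x, hx.1⟩ hx.2

/-- The part of the right half-plane above the graph of `ψ`, at vertical distance
less than `4π`. -/
def graphStrip (ψ : ℝ → ℝ) : Set ℂ :=
  {z | 0 < z.re ∧ z.im - ψ z.re ∈ Ioo 0 (4 * Real.pi)}

theorem continuousOn_im_sub_comp_re {ψ : ℝ → ℝ} (hψ : ContinuousOn ψ (Ioi 0)) :
    ContinuousOn (fun z : ℂ => z.im - ψ z.re) {z | 0 < z.re} :=
  continuous_im.continuousOn.sub (hψ.comp continuous_re.continuousOn fun _ hz => hz)

theorem isOpen_graphStrip {ψ : ℝ → ℝ} (hψ : ContinuousOn ψ (Ioi 0)) : IsOpen (graphStrip ψ) :=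
  (continuousOn_im_sub_comp_re hψ).isOpen_inter_preimage (isOpen_lt continuous_const continuous_re)
    isOpen_Ioo

theorem isSimplyConnected_graphStrip {ψ : ℝ → ℝ} (hψ : ContinuousOn ψ (Ioi 0)) :
    IsSimplyConnected (graphStrip ψ) := by
  set Q : Set (ℝ × ℝ) := Ioi 0 ×ˢ Ioo 0 (4 * Real.pi)
  have hQ : ContractibleSpace Q := ((convex_Ioi 0).prod (convex_Ioo _ _)).contractibleSpace
    ⟨(1, Real.pi), by simp [Q, Real.pi_pos]⟩
  let e : graphStrip ψ ≃ₜ Q :=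
    { toFun := fun z => ⟨(z.1.re, z.1.im - ψ z.1.re), z.2⟩
      invFun := fun p => ⟨⟨p.1.1, p.1.2 + ψ p.1.1⟩, p.2.1, by simpa using p.2.2⟩
      left_inv := fun z => by ext; simp
      right_inv := fun p => by ext <;> simp
      continuous_toFun := by
        refine Continuous.subtype_mk (Continuous.prodMk (by fun_prop) ?_) _
        exact (continuousOn_iff_continuous_domRestrict.1
          ((continuousOn_im_sub_comp_re hψ).mono fun z hz => hz.1))
      continuous_invFun := by
        have h1 : Continuous fun p : Q => ψ p.1.1 :=
          hψ.comp_continuous (by fun_prop) fun p => p.2.1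
        refine Continuous.subtype_mk ?_ _
        exact equivRealProdCLM.symm.continuous.comp
          (Continuous.prodMk (by fun_prop) (Continuous.add (by fun_prop) h1)) }
  exact e.toHomotopyEquiv.simplyConnectedSpace

/-- Mean value property on the circle `AddCircle 1`. -/
theorem integral_re_eq_of_differentiableOn {F : ℂ → ℂ} (hF : DifferentiableOn ℂ F unitDisk)
    {r : ℝ} (hr0 : 0 ≤ r) (hr1 : r < 1) :
    ∫ θ : AddCircle (1 : ℝ), (F (r * (AddCircle.toCircle θ : ℂ))).re = (F 0).re := by
  have hsub : Metric.closedBall (0 : ℂ) |r| ⊆ unitDisk :=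
    Metric.closedBall_subset_ball (by rwa [abs_of_nonneg hr0])
  have hdiff : DiffContOnCl ℂ F (Metric.ball 0 |r|) :=
    (hF.mono (Metric.closure_ball_subset_closedBall.trans hsub)).diffContOnCl
  have hcirc : CircleIntegrable F 0 r :=
    (hF.continuousOn.mono (Metric.sphere_subset_closedBall.trans hsub)).circleIntegrable'
  have havg := hdiff.circleAverage
  rw [Real.circleAverage_def] at havg
  have hcm : ∀ a : ℝ, circleMap 0 r ((2 * Real.pi) * a) =
      r * (AddCircle.toCircle ((a : ℝ) : AddCircle (1 : ℝ)) : ℂ) := fun a => by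
    rw [AddCircle.toCircle_apply_mk, Circle.coe_exp, circleMap]
    simp
  rw [← AddCircle.intervalIntegral_preimage 1 0]
  simp_rw [← hcm]
  rw [zero_add, intervalIntegral.integral_comp_mul_left (fun t => (F (circleMap 0 r t)).re)
    (by positivity), mul_zero, mul_one, ← havg, smul_re]
  congr 1
  exact reCLM.intervalIntegral_comp_comm hcirc

/-- If a positive harmonic function is eventually at least `M` along the radii ending in `A`,
then the measure of `A` is at most the value of the function at the origin divided by `M`. -/
theorem ofReal_mul_volume_le {F : ℂ → ℂ} (hF : DifferentiableOn ℂ F unitDisk)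
    (hpos : ∀ z ∈ unitDisk, 0 ≤ (F z).re) {A : Set (AddCircle (1 : ℝ))} {M : ℝ}
    (hA : ∀ θ ∈ A, ∀ᶠ r : ℝ in 𝓝[<] 1, M ≤ (F (r * (AddCircle.toCircle θ : ℂ))).re) :
    ENNReal.ofReal M * volume A ≤ ENNReal.ofReal (F 0).re := by
  obtain ⟨r, -, hr, hlim⟩ := exists_seq_strictMono_tendsto' (show (0 : ℝ) < 1 from one_pos)
  have hlim' : Tendsto r atTop (𝓝[<] 1) :=
    tendsto_nhdsWithin_iff.2 ⟨hlim, .of_forall fun n => (hr n).2⟩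
  have hmem : ∀ n (θ : AddCircle (1 : ℝ)), (r n * (AddCircle.toCircle θ : ℂ)) ∈ unitDisk := by
    intro n θ
    rw [unitDisk, mem_ball_zero_iff, norm_mul, Circle.norm_coe, mul_one, norm_real,
      Real.norm_of_nonneg (hr n).1.le]
    exact (hr n).2
  have hcont : ∀ n, Continuous fun θ : AddCircle (1 : ℝ) =>
      (F (r n * (AddCircle.toCircle θ : ℂ))).re := fun n =>
    continuous_re.comp (hF.continuousOn.comp_continuous (continuous_const.mul
      (continuous_subtype_val.comp AddCircle.continuous_toCircle)) (hmem n))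
  set f : ℕ → AddCircle (1 : ℝ) → ℝ≥0∞ := fun n θ =>
    ENNReal.ofReal (F (r n * (AddCircle.toCircle θ : ℂ))).re
  have hfm : ∀ n, Measurable (f n) := fun n => (hcont n).measurable.ennreal_ofReal
  have hfi : ∀ n, ∫⁻ θ, f n θ = ENNReal.ofReal (F 0).re := fun n => by
    rw [← integral_re_eq_of_differentiableOn hF (hr n).1.le (hr n).2]
    exact (ofReal_integral_eq_lintegral_ofReal
      ((hcont n).integrable_of_hasCompactSupport (HasCompactSupport.of_compactSpace _))
      (.of_forall fun θ => hpos _ (hmem n θ))).symm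
  have hsub : A ⊆ {θ | ENNReal.ofReal M ≤ liminf (fun n => f n θ) atTop} := fun θ hθ =>
    le_liminf_of_le (by isBoundedDefault)
      ((hlim'.eventually (hA θ hθ)).mono fun n hn => ENNReal.ofReal_le_ofReal hn)
  calc ENNReal.ofReal M * volume A
      ≤ ENNReal.ofReal M * volume {θ | ENNReal.ofReal M ≤ liminf (fun n => f n θ) atTop} := by
        gcongr
    _ ≤ ∫⁻ θ, liminf (fun n => f n θ) atTop :=
        mul_meas_ge_le_lintegral (Measurable.liminf hfm) _
    _ ≤ liminf (fun n => ∫⁻ θ, f n θ) atTop := lintegral_liminf_le hfm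
    _ = ENNReal.ofReal (F 0).re := by simp [hfi]

/-- `exp` restricted to `-graphStrip ψ` is at most two-to-one. -/
theorem encard_inter_preimage_exp_neg_le_two {g : ℂ → ℂ} {ψ : ℝ → ℝ} (hg : InjOn g unitDisk)
    (hmaps : MapsTo g unitDisk (graphStrip ψ)) (w : ℂ) :
    (unitDisk ∩ (fun z => exp (-g z)) ⁻¹' {w}).encard ≤ 2 := by
  have key : ∀ a ∈ unitDisk ∩ (fun z => exp (-g z)) ⁻¹' {w},
      ∀ b ∈ unitDisk ∩ (fun z => exp (-g z)) ⁻¹' {w}, a ≠ b →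
      ∃ n : ℤ, (n = 1 ∨ n = -1) ∧ (g a).im - (g b).im = n * (2 * Real.pi) := by
    rintro a ⟨ha, haw⟩ b ⟨hb, hbw⟩ hab
    obtain ⟨n, hn⟩ := exp_eq_exp_iff_exists_int.1 (haw.trans hbw.symm)
    have hre : (g a).re = (g b).re := by
      have := congrArg re hn
      simp at this
      linarith
    have him : (g b).im - (g a).im = n * (2 * Real.pi) := by
      have := congrArg im hn
      simp at this
      linarith
    have h1 := (hmaps ha).2
    have h2 := (hmaps hb).2
    rw [hre] at h1
    have hpi := Real.pi_pos
    have hn0 : n ≠ 0 := by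
      rintro rfl
      refine hab (hg ha hb (Complex.ext hre ?_))
      simp at him
      linarith
    have hn1 : (n : ℝ) < 2 := by nlinarith [h1.1, h1.2, h2.1, h2.2]
    have hn2 : (-2 : ℝ) < n := by nlinarith [h1.1, h1.2, h2.1, h2.2]
    have hn1' : n < 2 := by exact_mod_cast hn1
    have hn2' : -2 < n := by exact_mod_cast hn2
    exact ⟨-n, by omega, by push_cast; linarith⟩
  by_contra! h
  obtain ⟨t, ht, ht3⟩ := Set.exists_subset_encard_eq (k := 3) (Order.add_one_le_of_lt h)
  obtain ⟨a, b, c, hab, hac, hbc, rfl⟩ := Set.encard_eq_three.1 ht3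
  obtain ⟨m, hm, hm'⟩ := key a (ht (by simp)) b (ht (by simp)) hab
  obtain ⟨n, hn, hn'⟩ := key b (ht (by simp)) c (ht (by simp)) hbc
  obtain ⟨k, hk, hk'⟩ := key a (ht (by simp)) c (ht (by simp)) hac
  have hpi := Real.pi_pos
  have : (k : ℝ) = m + n := by
    have : (k : ℝ) * (2 * Real.pi) = (m + n) * (2 * Real.pi) := by linarith
    exact mul_right_cancel₀ (by positivity) this
  have : k = m + n := by exact_mod_cast this
  omega

/-- `exp` maps `-graphStrip ψ` onto the punctured disk. -/
theorem image_exp_neg_graphStrip (ψ : ℝ → ℝ) :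
    (fun z => exp (-z)) '' graphStrip ψ = unitDisk \ {0} := by
  refine Subset.antisymm ?_ ?_
  · rintro _ ⟨z, hz, rfl⟩
    refine ⟨?_, by simp⟩
    simpa [unitDisk, norm_exp] using hz.1
  · rintro w ⟨hw, hw0⟩
    have hw0' : w ≠ 0 := hw0
    have hw1 : ‖w‖ < 1 := by simpa [unitDisk] using hw
    set x := -(log w).re with hx
    obtain ⟨n, hn, -⟩ := existsUnique_add_zsmul_mem_Ioc Real.two_pi_pos (-(log w).im) (ψ x)
    refine ⟨-log w + n * (2 * Real.pi * I), ⟨?_, ?_⟩, ?_⟩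
    · simpa [log_re] using Real.log_neg (norm_pos_iff.2 hw0') hw1
    · have e1 : (-log w + n * (2 * Real.pi * I)).re = x := by simp [hx]
      have e2 : (-log w + n * (2 * Real.pi * I)).im = -(log w).im + n • (2 * Real.pi) := by simp
      rw [e1, e2]
      constructor <;> linarith [hn.1, hn.2, Real.pi_pos]
    · have : -(-log w + n * (2 * Real.pi * I)) = log w - n * (2 * Real.pi * I) := by ring
      simp only [this]
      rw [exp_sub, exp_log hw0', exp_int_mul_two_pi_mul_I, div_one]

/-- If `exp (-x) > 1 - 2 * h` with `0 < h ≤ 1 / 8`, then `x < 4 * h`. -/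
theorem lt_of_one_sub_lt_exp_neg {x h : ℝ} (h0 : 0 < h) (h1 : h ≤ 1 / 8)
    (hx : 1 - 2 * h < Real.exp (-x)) : x < 4 * h := by
  by_contra! hxh
  have h2 : Real.exp (-x) ≤ (1 + 4 * h)⁻¹ := by
    rw [Real.exp_neg]
    gcongr
    linarith [Real.add_one_le_exp x]
  have h3 : (1 + 4 * h)⁻¹ ≤ 1 - 2 * h := by
    rw [inv_le_iff_one_le_mul₀ (by positivity)]
    nlinarith
  linarith

/-- For every non-decreasing `δ : (0,1) → (0,1)` there is a two-valent
symbol `φ` with `φ(𝔻) = 𝔻 \ {0}` and `h₀ ∈ (0,1)` with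
`m({|φ*| ≥ 1 - h}) ≤ δ(h)` for `0 < h ≤ h₀`. -/
theorem stmt_0 (δ : ℝ → ℝ) (hδmem : ∀ h ∈ Set.Ioo (0 : ℝ) 1, δ h ∈ Set.Ioo (0 : ℝ) 1)
    (hδmono : MonotoneOn δ (Set.Ioo (0 : ℝ) 1)) :
    ∃ φ : ℂ → ℂ, IsSymbol φ ∧ Valent φ 2 ∧ φ '' unitDisk = unitDisk \ {0} ∧
      ∃ h₀ ∈ Set.Ioo (0 : ℝ) 1, ∀ h : ℝ, 0 < h → h ≤ h₀ →
        volume {θ : AddCircle (1 : ℝ) | ∃ w : ℂ, HasRadialLimit φ θ w ∧ 1 - h ≤ ‖w‖}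
          ≤ ENNReal.ofReal (δ h) := by
  have hδpos : ∀ x ∈ Ioo (0 : ℝ) 1, 0 < δ (x / 4) := fun x hx =>
    (hδmem _ ⟨by linarith [hx.1], by linarith [hx.2]⟩).1
  obtain ⟨ψ, hψ, hψG⟩ := exists_continuousOn_ge_of_antitoneOn
    (G := fun x => Real.exp (1 / (x * δ (x / 4)))) (fun x hx y hy hxy => by
      have h1 := hδpos x hx
      have h2 := hx.1
      have h4 := hy.1.le
      have h3 : δ (x / 4) ≤ δ (y / 4) := hδmono ⟨by linarith [hx.1], by linarith [hx.2]⟩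
        ⟨by linarith [hy.1], by linarith [hy.2]⟩ (by linarith)
      dsimp only
      gcongr)
  have hre : ∀ z ∈ graphStrip ψ, 0 < z.re := fun z hz => hz.1
  obtain ⟨g, hgd, hg⟩ := exists_bijOn_ball_of_isSimplyConnected (isOpen_graphStrip hψ)
    (isSimplyConnected_graphStrip hψ) (exists_isDiskEmbedding_of_re_pos hre)
  have hgre : ∀ z ∈ unitDisk, 0 < (g z).re := fun z hz => hre _ (hg.mapsTo hz)
  have himage : (fun z => exp (-g z)) '' unitDisk = unitDisk \ {0} := by
    rw [← image_exp_neg_graphStrip ψ, ← hg.image_eq, image_image]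
    rfl
  have hnorm : ∀ z, ‖exp (-g z)‖ = Real.exp (-(g z).re) := fun z => by rw [norm_exp, neg_re]
  have hslit : ∀ z ∈ unitDisk, 1 + g z ∈ slitPlane := fun z hz => by
    left; simp; linarith [hgre z hz]
  set F : ℂ → ℂ := fun z => log (1 + g z)
  have hFd : DifferentiableOn ℂ F unitDisk := (hgd.const_add 1).clog hslit
  have hFpos : ∀ z ∈ unitDisk, 0 ≤ (F z).re := fun z hz => by
    rw [log_re]
    refine Real.log_nonneg ?_
    refine le_trans ?_ (re_le_norm _)
    simpa using (hgre z hz).le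
  refine ⟨fun z => exp (-g z), ⟨?_, hgd.neg.cexp, ?_⟩,
    fun w _ => encard_inter_preimage_exp_neg_le_two hg.injOn hg.mapsTo w, himage, ?_⟩
  · exact fun z hz => (himage.subset (mem_image_of_mem _ hz)).1
  · rintro ⟨c, hc⟩
    have hval : ∀ w ∈ unitDisk \ {0}, w = c := fun w hw => by
      obtain ⟨z, hz, rfl⟩ := himage.superset hw
      exact hc hz
    have h1 := hval (1 / 2) (by simp [unitDisk]; norm_num)
    have h2 := hval (1 / 3) (by simp [unitDisk]; norm_num)
    have := h1.trans h2.symm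
    norm_num at this
  · have hF0 : 0 ≤ (F 0).re := hFpos 0 (by simp [unitDisk])
    refine ⟨min (1 / 8) (1 / (4 * ((F 0).re + 1))), ⟨by positivity,
      (min_le_left _ _).trans_lt (by norm_num)⟩, fun h h0 hle => ?_⟩
    have h8 : h ≤ 1 / 8 := hle.trans (min_le_left _ _)
    have hh : h ≤ 1 / (4 * ((F 0).re + 1)) := hle.trans (min_le_right _ _)
    rw [le_div_iff₀ (by positivity)] at hh
    have hδh : 0 < δ h := (hδmem h ⟨h0, by linarith⟩).1
    have hA := ofReal_mul_volume_le hFd hFpos (M := 1 / (4 * h * δ h))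
      (A := {θ : AddCircle (1 : ℝ) | ∃ w : ℂ,
        HasRadialLimit (fun z => exp (-g z)) θ w ∧ 1 - h ≤ ‖w‖}) (by
      rintro θ ⟨w, hw, hwh⟩
      have hev : ∀ᶠ r : ℝ in 𝓝[<] 1, 1 - 2 * h < ‖exp (-g (r * (AddCircle.toCircle θ : ℂ)))‖ :=
        hw.norm.eventually_const_lt (by linarith)
      filter_upwards [hev, Ioo_mem_nhdsLT (zero_lt_one' ℝ)] with r hr hr01
      have hz : (r * (AddCircle.toCircle θ : ℂ)) ∈ unitDisk := by
        rw [unitDisk, mem_ball_zero_iff, norm_mul, Circle.norm_coe, mul_one, norm_real,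
          Real.norm_of_nonneg hr01.1.le]
        exact hr01.2
      generalize (r * (AddCircle.toCircle θ : ℂ)) = z at hr hz
      rw [hnorm] at hr
      have hx := lt_of_one_sub_lt_exp_neg h0 h8 hr
      have hx0 := hgre z hz
      have hx1 : (g z).re ∈ Ioo (0 : ℝ) 1 := ⟨hx0, by linarith⟩
      have hδx := hδpos _ hx1
      have hmono : δ ((g z).re / 4) ≤ δ h :=
        hδmono ⟨by linarith, by linarith [hx1.2]⟩ ⟨h0, by linarith⟩ (by linarith)
      have him : Real.exp (1 / ((g z).re * δ ((g z).re / 4))) ≤ ‖1 + g z‖ := by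
        have h1 := (hg.mapsTo hz).2.1
        have h2 := (le_abs_self _).trans (abs_im_le_norm (1 + g z))
        simp at h2
        linarith [hψG _ hx1]
      rw [log_re]
      calc 1 / (4 * h * δ h) ≤ 1 / ((g z).re * δ ((g z).re / 4)) := by gcongr
        _ ≤ Real.log ‖1 + g z‖ := (Real.le_log_iff_exp_le ((Real.exp_pos _).trans_le him)).2 him)
    have hM : 0 < 1 / (4 * h * δ h) := by positivity
    rw [mul_comm, ← ENNReal.le_div_iff_mul_le (Or.inl (ENNReal.ofReal_pos.2 hM).ne')
      (Or.inl ENNReal.ofReal_ne_top),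
      ← ENNReal.ofReal_div_of_pos hM] at hA
    refine hA.trans (ENNReal.ofReal_le_ofReal ?_)
    rw [div_div_eq_mul_div, div_one]
    nlinarith

end
end

section
/- There exists a surjective four-valent symbol ψ: D → D (i.e. ψ(D) = D and every w ∈ D has at most four ψ-preimages) such that the composition operator C_ψ: H² → H² belongs to every Schatten class S_p for p > 0; that is, ∑_{n≥1} a_n(C_ψ)^p < ∞ for every p > 0. -/
open Complex MeasureTheory Set Filter
open scoped ENNReal Topology

noncomputable section

lemma zero_mem_unitDisk : (0 : ℂ) ∈ unitDisk := by simp [unitDisk]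

lemma mem_unitDisk {z : ℂ} : z ∈ unitDisk ↔ ‖z‖ < 1 := by simp [unitDisk]

lemma differentiableOn_tsum_mul_pow {a : ℕ → ℂ}
    (ha : ∀ z ∈ unitDisk, Summable fun n => a n * z ^ n) :
    DifferentiableOn ℂ (fun z => ∑' n, a n * z ^ n) unitDisk := by
  intro z hz
  obtain ⟨r, hzr, hr⟩ := exists_between (mem_unitDisk.1 hz)
  have hr0 : 0 ≤ r := (norm_nonneg z).trans hzr.le
  have hs := (ha r (by rw [mem_unitDisk]; simpa [abs_of_nonneg hr0] using hr)).norm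
  have hd := Complex.differentiableOn_tsum_of_summable_norm (U := Metric.ball (0 : ℂ) r)
    (F := fun n z => a n * z ^ n) hs (fun n => by fun_prop) Metric.isOpen_ball
    (fun n w hw => by
      have hw' : ‖w‖ ≤ r := by simpa using (mem_ball_zero_iff.1 hw).le
      simp only [norm_mul, norm_pow, Complex.norm_real, Real.norm_eq_abs, abs_of_nonneg hr0]
      gcongr)
  exact (hd.differentiableAt (Metric.isOpen_ball.mem_nhds (by simpa using hzr))).differentiableWithinAt

lemma sphere_subset_unitDisk {r : ℝ} (hr0 : 0 < r) (hr : r < 1) :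
    Metric.sphere (0 : ℂ) |r| ⊆ unitDisk := fun z hz => by
  rw [mem_unitDisk, mem_sphere_zero_iff_norm.1 hz, abs_of_pos hr0]; exact hr

lemma circleAverage_of_differentiableOn {F : ℂ → ℂ} (hF : DifferentiableOn ℂ F unitDisk) {r : ℝ}
    (hr0 : 0 < r) (hr : r < 1) : Real.circleAverage F 0 r = F 0 := by
  apply DiffContOnCl.circleAverage
  apply DifferentiableOn.diffContOnCl
  apply hF.mono
  rw [closure_ball _ (by simp [hr0.ne'])]
  intro z hz
  rw [mem_unitDisk]
  rw [mem_closedBall_zero_iff, abs_of_pos hr0] at hz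
  linarith

lemma circleAverage_re_of_differentiableOn {F : ℂ → ℂ} (hF : DifferentiableOn ℂ F unitDisk) {r : ℝ}
    (hr0 : 0 < r) (hr : r < 1) : Real.circleAverage (fun z => (F z).re) 0 r = (F 0).re := by
  have hi : CircleIntegrable F 0 r :=
    (hF.continuousOn.mono (sphere_subset_unitDisk hr0 hr)).circleIntegrable'
  have := Complex.reCLM.circleAverage_comp_comm hi
  rw [circleAverage_of_differentiableOn hF hr0 hr] at this
  exact this

lemma norm_add_sq_eq (a w : ℂ) :
    ‖a + w‖ ^ 2 = ‖a‖ ^ 2 + ‖w‖ ^ 2 + (2 * (starRingEnd ℂ) a * w).re := by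
  simp only [Complex.sq_norm, Complex.normSq_apply, Complex.mul_re, Complex.mul_im,
    Complex.add_re, Complex.add_im, Complex.conj_re, Complex.conj_im, Complex.re_ofNat,
    Complex.im_ofNat]
  ring

/-- Bessel's inequality for a power series on the circle of radius `r`. -/
lemma sum_sq_le_circleAverage {r : ℝ} (hr0 : 0 < r) (hr : r < 1) (N : ℕ) :
    ∀ a : ℕ → ℂ, (∀ z ∈ unitDisk, Summable fun n => a n * z ^ n) →
      ∑ n ∈ Finset.range N, ‖a n‖ ^ 2 * r ^ (2 * n) ≤
        Real.circleAverage (fun z => ‖∑' n, a n * z ^ n‖ ^ 2) 0 r := by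
  induction N with
  | zero =>
    intro a _
    simpa using Real.circleAverage_nonneg_of_nonneg (fun z _ => by positivity)
  | succ N ih =>
    intro a ha
    have hb : ∀ z ∈ unitDisk, Summable fun n => a (n + 1) * z ^ n := by
      intro z hz
      rcases eq_or_ne z 0 with rfl | hz0
      · apply summable_of_ne_finset_zero (s := {0})
        intro n hn
        simp at hn
        simp [hn]
      · have := ((summable_nat_add_iff 1).2 (ha z hz)).mul_right z⁻¹
        refine this.congr fun n => ?_
        field_simp
        ring
    set g : ℂ → ℂ := fun z => ∑' n, a (n + 1) * z ^ n with hg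
    have hgd : DifferentiableOn ℂ g unitDisk := differentiableOn_tsum_mul_pow hb
    have hsph := sphere_subset_unitDisk hr0 hr
    have hfg : ∀ z ∈ unitDisk, ∑' n, a n * z ^ n = a 0 + z * g z := by
      intro z hz
      rw [(ha z hz).tsum_eq_zero_add, hg, ← tsum_mul_left]
      simp only [pow_zero, mul_one]
      congr 1
      exact tsum_congr fun n => by ring
    have hcross : DifferentiableOn ℂ (fun z => 2 * (starRingEnd ℂ) (a 0) * (z * g z)) unitDisk := by
      fun_prop
    have heq : Set.EqOn (fun z => ‖∑' n, a n * z ^ n‖ ^ 2)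
        (fun z => (‖a 0‖ ^ 2 + r ^ 2 • ‖g z‖ ^ 2) +
          (2 * (starRingEnd ℂ) (a 0) * (z * g z)).re) (Metric.sphere 0 |r|) := by
      intro z hz
      have hzr : ‖z‖ = r := by rw [mem_sphere_zero_iff_norm.1 hz, abs_of_pos hr0]
      simp only [hfg z (hsph hz), norm_add_sq_eq, norm_mul, hzr, mul_pow, smul_eq_mul]
    have hi2 : CircleIntegrable (fun z => (2 * (starRingEnd ℂ) (a 0) * (z * g z)).re) 0 r :=
      (Complex.continuous_re.comp_continuousOn (hcross.continuousOn.mono hsph)).circleIntegrable'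
    have hi3 : CircleIntegrable (fun z => r ^ 2 • ‖g z‖ ^ 2) 0 r :=
      (((hgd.continuousOn.mono hsph).norm.pow 2).const_smul (r ^ 2)).circleIntegrable'
    have hi0 : CircleIntegrable (fun _ => ‖a 0‖ ^ 2) (0 : ℂ) r :=
      continuousOn_const.circleIntegrable'
    have hi4 : CircleIntegrable (fun z => ‖a 0‖ ^ 2 + r ^ 2 • ‖g z‖ ^ 2) 0 r := hi0.add hi3
    rw [Real.circleAverage_congr_sphere heq, Real.circleAverage_fun_add hi4 hi2,
      Real.circleAverage_fun_add hi0 hi3, Real.circleAverage_const, Real.circleAverage_fun_smul,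
      circleAverage_re_of_differentiableOn hcross hr0 hr]
    have := ih _ hb
    rw [Finset.sum_range_succ']
    simp only [zero_mul, mul_zero, Complex.zero_re, add_zero, pow_zero, mul_one, smul_eq_mul]
    rw [add_comm]
    gcongr
    refine le_trans (le_of_eq ?_) (mul_le_mul_of_nonneg_left this (sq_nonneg r))
    rw [Finset.mul_sum]
    exact Finset.sum_congr rfl fun n _ => by ring

lemma exists_powerSeries {f : ℂ → ℂ} (hf : DifferentiableOn ℂ f unitDisk) :
    ∃ a : ℕ → ℂ, ∀ z ∈ unitDisk, HasSum (fun n => a n * z ^ n) (f z) := by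
  refine ⟨fun n => (n.factorial : ℂ)⁻¹ * iteratedDeriv n f 0, fun z hz => ?_⟩
  refine (Complex.hasSum_taylorSeries_on_ball hf hz).congr_fun ?_
  intro n
  simp only [sub_zero, smul_eq_mul]
  ring

lemma sum_sq_le_of_harmonic_majorant {f G : ℂ → ℂ} (hG : DifferentiableOn ℂ G unitDisk)
    (hfG : ∀ z ∈ unitDisk, ‖f z‖ ^ 2 ≤ (G z).re) {a : ℕ → ℂ}
    (ha : ∀ z ∈ unitDisk, HasSum (fun n => a n * z ^ n) (f z)) (N : ℕ) :
    ∑ n ∈ Finset.range N, ‖a n‖ ^ 2 ≤ (G 0).re := by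
  have key : ∀ r ∈ Set.Ioo (0 : ℝ) 1,
      ∑ n ∈ Finset.range N, ‖a n‖ ^ 2 * r ^ (2 * n) ≤ (G 0).re := by
    intro r ⟨hr0, hr⟩
    have hsph := sphere_subset_unitDisk hr0 hr
    have hd := differentiableOn_tsum_mul_pow fun z hz => (ha z hz).summable
    refine (sum_sq_le_circleAverage hr0 hr N a fun z hz => (ha z hz).summable).trans ?_
    rw [← circleAverage_re_of_differentiableOn hG hr0 hr]
    refine Real.circleAverage_mono ((hd.continuousOn.mono hsph).norm.pow 2).circleIntegrable'
      (Complex.continuous_re.comp_continuousOn (hG.continuousOn.mono hsph)).circleIntegrable' ?_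
    intro z hz
    rw [(ha z (hsph hz)).tsum_eq]
    exact hfG z (hsph hz)
  have hcont : Continuous fun r : ℝ => ∑ n ∈ Finset.range N, ‖a n‖ ^ 2 * r ^ (2 * n) := by
    fun_prop
  have hlim := (hcont.tendsto 1).mono_left (nhdsWithin_le_nhds (s := Set.Iio 1))
  have := le_of_tendsto hlim (Filter.mem_of_superset (Ioo_mem_nhdsLT one_pos) key)
  simpa using this

/-- An analytic function with a harmonic majorant of its square lies in `H²`. -/
lemma exists_H2_of_harmonic_majorant {f G₀ : ℂ → ℂ} (hf : DifferentiableOn ℂ f unitDisk)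
    (hG₀ : DifferentiableOn ℂ G₀ unitDisk) (hfG₀ : ∀ z ∈ unitDisk, ‖f z‖ ^ 2 ≤ (G₀ z).re) :
    ∃ c : H2, (∀ z ∈ unitDisk, H2.eval c z = f z) ∧
      ∀ G : ℂ → ℂ, DifferentiableOn ℂ G unitDisk → (∀ z ∈ unitDisk, ‖f z‖ ^ 2 ≤ (G z).re) →
        ‖c‖ ^ 2 ≤ (G 0).re := by
  obtain ⟨a, ha⟩ := exists_powerSeries hf
  have hsum : ∀ G : ℂ → ℂ, DifferentiableOn ℂ G unitDisk →
      (∀ z ∈ unitDisk, ‖f z‖ ^ 2 ≤ (G z).re) →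
        ∀ s : Finset ℕ, ∑ n ∈ s, ‖a n‖ ^ (2 : ℝ≥0∞).toReal ≤ (G 0).re := by
    intro G hG hfG s
    obtain ⟨N, hN⟩ := s.exists_nat_subset_range
    simp only [ENNReal.toReal_ofNat, Real.rpow_ofNat]
    exact (Finset.sum_le_sum_of_subset_of_nonneg hN fun _ _ _ => by positivity).trans
      (sum_sq_le_of_harmonic_majorant hG hfG ha N)
  refine ⟨⟨a, memℓp_gen' (hsum G₀ hG₀ hfG₀)⟩, fun z hz => (ha z hz).tsum_eq, fun G hG hfG => ?_⟩
  have h0 : 0 ≤ (G 0).re := (sq_nonneg _).trans (hfG 0 zero_mem_unitDisk)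
  rw [← Real.le_sqrt (norm_nonneg _) h0]
  refine lp.norm_le_of_forall_sum_le (by simp) (Real.sqrt_nonneg _) fun s => ?_
  have := hsum G hG hfG s
  simpa [Real.sq_sqrt h0] using this

lemma norm_evalCLM_le (k : ℕ) :
    ‖(lp.evalCLM ℂ (fun _ : ℕ => ℂ) 2 k : H2 →L[ℂ] ℂ)‖ ≤ 1 :=
  ContinuousLinearMap.opNorm_le_bound _ zero_le_one fun f => by
    rw [one_mul]
    exact lp.norm_apply_le_norm (by simp) f k

/-- Point evaluation at `z ∈ 𝔻` is a bounded functional on `H²`. -/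
lemma exists_evalCLM {z : ℂ} (hz : z ∈ unitDisk) :
    ∃ E : H2 →L[ℂ] ℂ, ∀ a : H2, HasSum (fun n => a n * z ^ n) (E a) := by
  have hs : Summable fun n : ℕ => z ^ n • (lp.evalCLM ℂ (fun _ : ℕ => ℂ) 2 n : H2 →L[ℂ] ℂ) := by
    refine Summable.of_norm_bounded
      (summable_geometric_of_lt_one (norm_nonneg z) (mem_unitDisk.1 hz)) fun n => ?_
    rw [norm_smul, norm_pow]
    exact mul_le_of_le_one_right (by positivity) (norm_evalCLM_le n)
  refine ⟨∑' n : ℕ, z ^ n • lp.evalCLM ℂ (fun _ : ℕ => ℂ) 2 n, fun a => ?_⟩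
  have := (ContinuousLinearMap.apply ℂ ℂ a).hasSum hs.hasSum
  exact this.congr_fun fun n => mul_comm _ _

lemma approxNum_nonneg {E F : Type*} [NormedAddCommGroup E] [NormedAddCommGroup F]
    [NormedSpace ℂ E] [NormedSpace ℂ F] (n : ℕ) (T : E →L[ℂ] F) : 0 ≤ approxNum n T :=
  Real.sInf_nonneg fun _ ⟨_, _, h⟩ => h ▸ norm_nonneg _

lemma approxNum_le {E F : Type*} [NormedAddCommGroup E] [NormedAddCommGroup F]
    [NormedSpace ℂ E] [NormedSpace ℂ F] {n : ℕ} {T R : E →L[ℂ] F}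
    (hR : Module.rank ℂ (LinearMap.range (R : E →ₗ[ℂ] F)) < (n : Cardinal)) :
    approxNum n T ≤ ‖T - R‖ :=
  csInf_le ⟨0, fun _ ⟨_, _, h⟩ => h ▸ norm_nonneg _⟩ ⟨R, hR, rfl⟩

/-- A sum of rank-one operators with rapidly decreasing norms has rapidly decreasing approximation
numbers. -/
lemma approxNum_succ_le_tsum {E F : Type} [NormedAddCommGroup E] [NormedAddCommGroup F]
    [NormedSpace ℂ E] [NormedSpace ℂ F] [CompleteSpace F] (l : ℕ → E →L[ℂ] ℂ) (c : ℕ → F)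
    (hl : ∀ k, ‖l k‖ ≤ 1) (hc : Summable fun k => ‖c k‖) (n : ℕ) :
    approxNum (n + 1) (∑' k, (l k).smulRight (c k)) ≤ ∑' k, ‖c (k + n)‖ := by
  have hle : ∀ k, ‖(l k).smulRight (c k)‖ ≤ ‖c k‖ := fun k => by
    rw [ContinuousLinearMap.norm_smulRight_apply]
    exact mul_le_of_le_one_left (norm_nonneg _) (hl k)
  have hs : Summable fun k => (l k).smulRight (c k) := Summable.of_norm_bounded hc hle
  refine (approxNum_le (R := ∑ k ∈ Finset.range n, (l k).smulRight (c k)) ?_).trans ?_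
  · have h1 : ((∑ k ∈ Finset.range n, (l k).smulRight (c k) : E →L[ℂ] F) : E →ₗ[ℂ] F) =
        ∑ k ∈ Finset.range n, (((l k).smulRight (c k) : E →L[ℂ] F) : E →ₗ[ℂ] F) := by
      ext x
      simp
    have h2 : ∀ k, LinearMap.rank (((l k).smulRight (c k) : E →L[ℂ] F) : E →ₗ[ℂ] F) ≤ 1 := by
      intro k
      refine (Submodule.rank_mono (t := Submodule.span ℂ {c k}) ?_).trans ?_
      · rintro _ ⟨x, rfl⟩
        exact Submodule.mem_span_singleton.2 ⟨l k x, rfl⟩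
      · exact (rank_span_le _).trans (by simp)
    have h3 : LinearMap.rank ((∑ k ∈ Finset.range n, (l k).smulRight (c k) : E →L[ℂ] F) :
        E →ₗ[ℂ] F) ≤ n := by
      rw [h1]
      refine (LinearMap.rank_finsetSum_le _ _).trans ?_
      refine (Finset.sum_le_sum fun k _ => h2 k).trans ?_
      simp
    refine lt_of_le_of_lt h3 ?_
    exact_mod_cast Nat.lt_succ_self n
  · rw [← hs.sum_add_tsum_nat_add n, add_sub_cancel_left]
    exact tsum_of_norm_bounded ((summable_nat_add_iff n).2 hc).hasSum fun k => hle (k + n)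

/-- If every `(k + 1) ^ N * ‖ψ ^ k‖ ^ 2` is dominated by a harmonic function independent of `k`,
then `ψ` induces a composition operator lying in every Schatten class. -/
theorem exists_isCompOp_summable {ψ : ℂ → ℂ} (hψ : DifferentiableOn ℂ ψ unitDisk)
    (hmaps : Set.MapsTo ψ unitDisk unitDisk)
    (hmaj : ∀ N : ℕ, ∃ G : ℂ → ℂ, DifferentiableOn ℂ G unitDisk ∧
      ∀ z ∈ unitDisk, ∀ k : ℕ, ((k : ℝ) + 1) ^ N * ‖ψ z‖ ^ (2 * k) ≤ (G z).re) :
    ∃ T : H2 →L[ℂ] H2, IsCompOp ψ T ∧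
      ∀ p : ℝ, 0 < p → Summable (fun n : ℕ => approxNum (n + 1) T ^ p) := by
  have hex : ∀ k : ℕ, ∃ c : H2, (∀ z ∈ unitDisk, H2.eval c z = ψ z ^ k) ∧
      ∀ G : ℂ → ℂ, DifferentiableOn ℂ G unitDisk →
        (∀ z ∈ unitDisk, ‖ψ z ^ k‖ ^ 2 ≤ (G z).re) → ‖c‖ ^ 2 ≤ (G 0).re := fun k =>
    exists_H2_of_harmonic_majorant (hψ.pow k) (differentiableOn_const 1) fun z hz => by
      have := mem_unitDisk.1 (hmaps hz)
      rw [norm_pow, ← pow_mul, Complex.one_re]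
      exact pow_le_one₀ (norm_nonneg _) this.le
  choose c hc hcG using hex
  have hdecay : ∀ N : ℕ, ∃ C : ℝ, 0 ≤ C ∧ ∀ k : ℕ, ‖c k‖ ≤ C * (((k : ℝ) + 1) ^ N)⁻¹ := by
    intro N
    obtain ⟨G, hG, hGk⟩ := hmaj (2 * N)
    refine ⟨Real.sqrt (G 0).re, Real.sqrt_nonneg _, fun k => ?_⟩
    have hk : (0 : ℝ) < (((k : ℝ) + 1) ^ N) := by positivity
    have h := hcG k (fun z => ((((k : ℝ) + 1) ^ (2 * N))⁻¹ : ℝ) * G z) (hG.const_mul _) fun z hz => by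
      rw [Complex.re_ofReal_mul, norm_pow, ← pow_mul, mul_comm k 2,
        ← div_eq_inv_mul, le_div_iff₀ (by positivity), mul_comm]
      exact hGk z hz k
    rw [Complex.re_ofReal_mul] at h
    rw [← div_eq_mul_inv, le_div_iff₀ hk]
    refine Real.le_sqrt_of_sq_le ?_
    rw [mul_pow, ← pow_mul, mul_comm N 2]
    rwa [← div_eq_inv_mul, le_div_iff₀ (by positivity)] at h
  have hpow : ∀ N : ℕ, Summable fun k : ℕ => (((k : ℝ) + 1) ^ (N + 2))⁻¹ := by
    intro N
    have := (summable_nat_add_iff 1).2 (Real.summable_nat_pow_inv (p := N + 2).2 (by omega))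
    simpa using this
  have hcs : Summable fun k => ‖c k‖ := by
    obtain ⟨C, -, hC⟩ := hdecay 2
    exact Summable.of_nonneg_of_le (fun _ => norm_nonneg _) hC ((hpow 0).mul_left C)
  set l : ℕ → H2 →L[ℂ] ℂ := fun k => lp.evalCLM ℂ (fun _ : ℕ => ℂ) 2 k with hl
  have hs : Summable fun k => (l k).smulRight (c k) :=
    Summable.of_norm_bounded hcs fun k => by
      rw [ContinuousLinearMap.norm_smulRight_apply]
      exact mul_le_of_le_one_left (norm_nonneg _) (norm_evalCLM_le k)
  refine ⟨∑' k, (l k).smulRight (c k), ?_, ?_⟩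
  · intro a z hz
    obtain ⟨E, hE⟩ := exists_evalCLM hz
    have hEe : ∀ b : H2, H2.eval b z = E b := fun b => (hE b).tsum_eq
    have h := (E.comp (ContinuousLinearMap.apply ℂ H2 a : (H2 →L[ℂ] H2) →L[ℂ] H2)).hasSum hs.hasSum
    rw [hEe]
    refine h.unique ?_
    obtain ⟨E', hE'⟩ := exists_evalCLM (hmaps hz)
    have h2 := hE' a
    rw [show H2.eval a (ψ z) = E' a from h2.tsum_eq]
    refine h2.congr_fun fun k => ?_
    change E (a k • c k) = _
    rw [map_smul, ← hEe, hc k z hz, smul_eq_mul]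
  · intro p hp
    obtain ⟨N, hN⟩ := exists_nat_gt (1 / p)
    have hNp : 1 < N * p := by rwa [div_lt_iff₀ hp] at hN
    obtain ⟨C, hC0, hC⟩ := hdecay (N + 2)
    set S : ℝ := ∑' k : ℕ, (((k : ℝ) + 1) ^ 2)⁻¹ with hS
    have hS0 : 0 ≤ S := tsum_nonneg fun _ => by positivity
    have hbound : ∀ n : ℕ, approxNum (n + 1) (∑' k, (l k).smulRight (c k)) ≤
        C * S * (((n : ℝ) + 1) ^ N)⁻¹ := by
      intro n
      refine (approxNum_succ_le_tsum l c norm_evalCLM_le hcs n).trans ?_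
      have hmaj : ∀ k : ℕ, ‖c (k + n)‖ ≤ C * (((n : ℝ) + 1) ^ N)⁻¹ * (((k : ℝ) + 1) ^ 2)⁻¹ := by
        intro k
        refine (hC (k + n)).trans ?_
        rw [mul_assoc]
        refine mul_le_mul_of_nonneg_left ?_ hC0
        rw [← mul_inv, pow_add]
        push_cast
        gcongr <;> linarith [(Nat.cast_nonneg k : (0 : ℝ) ≤ k), (Nat.cast_nonneg n : (0 : ℝ) ≤ n)]
      refine (((summable_nat_add_iff n).2 hcs).tsum_le_tsum hmaj ((hpow 0).mul_left _)).trans ?_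
      rw [tsum_mul_left]
      exact le_of_eq (by rw [hS]; ring)
    have hsum : Summable fun n : ℕ => (C * S) ^ p * (((n : ℝ) + 1) ^ (N * p))⁻¹ := by
      refine Summable.mul_left _ ?_
      have := (summable_nat_add_iff 1).2 (Real.summable_nat_rpow_inv.2 hNp)
      simpa using this
    refine Summable.of_nonneg_of_le (fun n => Real.rpow_nonneg (approxNum_nonneg _ _) _)
      (fun n => ?_) hsum
    have hn : (0 : ℝ) ≤ (n : ℝ) + 1 := by positivity
    refine (Real.rpow_le_rpow (approxNum_nonneg _ _) (hbound n) hp.le).trans (le_of_eq ?_)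
    rw [Real.mul_rpow (by positivity) (by positivity), Real.inv_rpow (by positivity),
      ← Real.rpow_natCast, ← Real.rpow_mul hn]

/-- The conformal map of the disk onto the strip `|Im| < π / 2`. -/
def diskLog (z : ℂ) : ℂ := log ((1 + z) / (1 - z))

/-- The conformal map of the disk onto the strip `1 < Im < exp (4 * π)`. -/
def stripMap (z : ℂ) : ℂ :=
  ((Real.exp (4 * Real.pi) - 1) / Real.pi : ℝ) * diskLog z +
    ((1 + Real.exp (4 * Real.pi)) / 2 : ℝ) * I

/-- A two-valent map of the disk onto the annulus `exp (-π) < |w| < 1`. -/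
def annulusMap (z : ℂ) : ℂ := exp (log (stripMap z) * I)

/-- The disk automorphism vanishing at `1 / 2`. -/
def diskAut (v : ℂ) : ℂ := (2 * v - 1) / (2 - v)

/-- The four-valent surjective symbol. -/
def spiralSymbol (z : ℂ) : ℂ := diskAut (annulusMap z) ^ 2

lemma one_sub_ne_zero_of_mem {z : ℂ} (hz : z ∈ unitDisk) : 1 - z ≠ 0 := by
  intro h
  rw [mem_unitDisk, ← sub_eq_zero.1 h] at hz
  simp at hz

lemma cayley_re_pos {z : ℂ} (hz : z ∈ unitDisk) : 0 < ((1 + z) / (1 - z)).re := by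
  have h0 := Complex.normSq_pos.2 (one_sub_ne_zero_of_mem hz)
  have hz' : z.re * z.re + z.im * z.im < 1 := by
    rw [← Complex.normSq_apply, ← Complex.sq_norm]
    have := mem_unitDisk.1 hz
    nlinarith [norm_nonneg z]
  rw [Complex.div_re, ← add_div]
  apply div_pos _ h0
  simp
  nlinarith

lemma exp_diskLog {z : ℂ} (hz : z ∈ unitDisk) : exp (diskLog z) = (1 + z) / (1 - z) :=
  Complex.exp_log fun h => by simpa [h] using cayley_re_pos hz

lemma abs_diskLog_im_lt {z : ℂ} (hz : z ∈ unitDisk) : |(diskLog z).im| < Real.pi / 2 := by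
  rw [diskLog, Complex.log_im, Complex.abs_arg_lt_pi_div_two_iff]
  exact Or.inl (cayley_re_pos hz)

lemma diskLog_injOn : Set.InjOn diskLog unitDisk := by
  intro z hz w hw h
  have h' : (1 + z) / (1 - z) = (1 + w) / (1 - w) := by rw [← exp_diskLog hz, h, exp_diskLog hw]
  rw [div_eq_div_iff (one_sub_ne_zero_of_mem hz) (one_sub_ne_zero_of_mem hw)] at h'
  linear_combination h' / 2

lemma exists_diskLog_eq {s : ℂ} (hs : |s.im| < Real.pi / 2) : ∃ z ∈ unitDisk, diskLog z = s := by
  have him := abs_lt.1 hs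
  have hre : 0 < (exp s).re := by
    rw [Complex.exp_re]
    exact mul_pos (Real.exp_pos _) (Real.cos_pos_of_mem_Ioo ⟨by linarith, by linarith⟩)
  have hne : exp s + 1 ≠ 0 := fun h => by
    have := congrArg Complex.re h
    simp only [Complex.add_re, Complex.one_re, Complex.zero_re] at this
    linarith
  refine ⟨(exp s - 1) / (exp s + 1), ?_, ?_⟩
  · rw [mem_unitDisk, norm_div, div_lt_one (norm_pos_iff.2 hne)]
    refine lt_of_pow_lt_pow_left₀ 2 (norm_nonneg _) ?_
    rw [Complex.sq_norm, Complex.sq_norm, Complex.normSq_apply, Complex.normSq_apply]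
    simp only [Complex.sub_re, Complex.sub_im, Complex.add_re, Complex.add_im, Complex.one_re,
      Complex.one_im]
    nlinarith
  · have : (1 + (exp s - 1) / (exp s + 1)) / (1 - (exp s - 1) / (exp s + 1)) = exp s := by
      have h1 : 1 + (exp s - 1) / (exp s + 1) = 2 * exp s / (exp s + 1) := by field_simp; ring
      have h2 : 1 - (exp s - 1) / (exp s + 1) = 2 / (exp s + 1) := by field_simp; ring
      rw [h1, h2]
      field_simp
    rw [diskLog, this, Complex.log_exp] <;> linarith [Real.pi_pos]

lemma differentiableOn_diskLog : DifferentiableOn ℂ diskLog unitDisk := by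
  intro z hz
  have h : DifferentiableAt ℂ (fun w : ℂ => (1 + w) / (1 - w)) z :=
    DifferentiableAt.div (by fun_prop) (by fun_prop) (one_sub_ne_zero_of_mem hz)
  exact (h.clog (Or.inl (cayley_re_pos hz))).differentiableWithinAt

lemma one_lt_exp_four_pi : 1 < Real.exp (4 * Real.pi) := by
  rw [Real.one_lt_exp_iff]; positivity

lemma stripMap_slope_pos : 0 < (Real.exp (4 * Real.pi) - 1) / Real.pi :=
  div_pos (by linarith [one_lt_exp_four_pi]) Real.pi_pos

lemma stripMap_im (z : ℂ) : (stripMap z).im =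
    (Real.exp (4 * Real.pi) - 1) / Real.pi * (diskLog z).im + (1 + Real.exp (4 * Real.pi)) / 2 := by
  rw [stripMap, Complex.add_im, Complex.im_ofReal_mul, Complex.im_ofReal_mul, Complex.I_im, mul_one]

lemma stripMap_im_mem {z : ℂ} (hz : z ∈ unitDisk) :
    (stripMap z).im ∈ Set.Ioo 1 (Real.exp (4 * Real.pi)) := by
  have h := abs_lt.1 (abs_diskLog_im_lt hz)
  have hc := stripMap_slope_pos
  have hmul : (Real.exp (4 * Real.pi) - 1) / Real.pi * (Real.pi / 2) =
      (Real.exp (4 * Real.pi) - 1) / 2 := by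
    field_simp
  rw [stripMap_im]
  constructor <;> nlinarith

lemma stripMap_injOn : Set.InjOn stripMap unitDisk := by
  intro z hz w hw h
  refine diskLog_injOn hz hw ?_
  have hc : (((Real.exp (4 * Real.pi) - 1) / Real.pi : ℝ) : ℂ) ≠ 0 :=
    Complex.ofReal_ne_zero.2 stripMap_slope_pos.ne'
  exact mul_left_cancel₀ hc (add_right_cancel h)

lemma exists_stripMap_eq {s : ℂ} (hs : s.im ∈ Set.Ioo 1 (Real.exp (4 * Real.pi))) :
    ∃ z ∈ unitDisk, stripMap z = s := by
  have hc := stripMap_slope_pos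
  have hmul : (Real.exp (4 * Real.pi) - 1) / Real.pi * (Real.pi / 2) =
      (Real.exp (4 * Real.pi) - 1) / 2 := by
    field_simp
  set c := (Real.exp (4 * Real.pi) - 1) / Real.pi with hcdef
  obtain ⟨z, hz, h⟩ := exists_diskLog_eq
    (s := ((c⁻¹ : ℝ) : ℂ) * (s - ((1 + Real.exp (4 * Real.pi)) / 2 : ℝ) * I)) (by
      rw [Complex.im_ofReal_mul, Complex.sub_im, Complex.im_ofReal_mul, Complex.I_im, mul_one,
        abs_mul, abs_of_pos (inv_pos.2 hc), inv_mul_lt_iff₀ hc, hmul, abs_lt]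
      constructor <;> linarith [hs.1, hs.2])
  refine ⟨z, hz, ?_⟩
  rw [stripMap, h, ← mul_assoc, ← Complex.ofReal_mul, mul_inv_cancel₀ hc.ne']
  simp

lemma differentiableOn_stripMap : DifferentiableOn ℂ stripMap unitDisk :=
  (differentiableOn_diskLog.const_mul _).add_const _

lemma stripMap_ne_zero {z : ℂ} (hz : z ∈ unitDisk) : stripMap z ≠ 0 := fun h => by
  have := (stripMap_im_mem hz).1
  simp [h] at this
  linarith

lemma one_lt_norm_stripMap {z : ℂ} (hz : z ∈ unitDisk) : 1 < ‖stripMap z‖ :=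
  (stripMap_im_mem hz).1.trans_le (Complex.im_le_norm _)

lemma differentiableOn_annulusMap : DifferentiableOn ℂ annulusMap unitDisk := by
  intro z hz
  have h : stripMap z ∈ Complex.slitPlane := by
    right
    linarith [(stripMap_im_mem hz).1]
  exact (((differentiableOn_stripMap z hz).clog h).mul_const I).cexp

lemma norm_annulusMap (z : ℂ) : ‖annulusMap z‖ = Real.exp (-(stripMap z).arg) := by
  simp [annulusMap, Complex.norm_exp, Complex.log_im]

lemma norm_annulusMap_le {z : ℂ} (hz : z ∈ unitDisk) :
    ‖annulusMap z‖ ≤ Real.exp (-‖stripMap z‖⁻¹) := by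
  have him := (stripMap_im_mem hz).1
  have hn : 0 < ‖stripMap z‖ := norm_pos_iff.2 (stripMap_ne_zero hz)
  have harg : 0 ≤ (stripMap z).arg := Complex.arg_nonneg_iff.2 (by linarith)
  have hsin : Real.sin (stripMap z).arg = (stripMap z).im / ‖stripMap z‖ := Complex.sin_arg _
  have : ‖stripMap z‖⁻¹ ≤ (stripMap z).arg :=
    calc ‖stripMap z‖⁻¹ = 1 / ‖stripMap z‖ := (one_div _).symm
      _ ≤ (stripMap z).im / ‖stripMap z‖ := by gcongr
      _ ≤ _ := hsin ▸ Real.sin_le harg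
  rw [norm_annulusMap, Real.exp_le_exp]
  linarith

lemma norm_annulusMap_lt_one {z : ℂ} (hz : z ∈ unitDisk) : ‖annulusMap z‖ < 1 := by
  refine (norm_annulusMap_le hz).trans_lt ?_
  rw [Real.exp_lt_one_iff, neg_lt_zero, inv_pos, norm_pos_iff]
  exact stripMap_ne_zero hz

/-- On each half of the strip in logarithmic scale, `annulusMap` is injective. -/
lemma annulusMap_eq_imp {z w : ℂ} (hz : z ∈ unitDisk) (hw : w ∈ unitDisk)
    (h : annulusMap z = annulusMap w)
    (hzw : Real.log (stripMap z).im < 2 * Real.pi ↔ Real.log (stripMap w).im < 2 * Real.pi) :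
    z = w := by
  obtain ⟨n, hn⟩ := Complex.exp_eq_exp_iff_exists_int.1 h
  have hlog : log (stripMap z) = log (stripMap w) + ((n * (2 * Real.pi) : ℝ) : ℂ) := by
    apply mul_right_cancel₀ Complex.I_ne_zero
    rw [hn]
    push_cast
    ring
  have hstrip : stripMap z = (Real.exp (n * (2 * Real.pi)) : ℝ) * stripMap w := by
    rw [← Complex.exp_log (stripMap_ne_zero hz), hlog, Complex.exp_add,
      Complex.exp_log (stripMap_ne_zero hw), Complex.ofReal_exp, mul_comm]
  obtain ⟨hz1, hz2⟩ := stripMap_im_mem hz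
  obtain ⟨hw1, hw2⟩ := stripMap_im_mem hw
  have him : Real.log (stripMap z).im = n * (2 * Real.pi) + Real.log (stripMap w).im := by
    rw [hstrip, Complex.im_ofReal_mul, Real.log_mul (Real.exp_pos _).ne' (by linarith),
      Real.log_exp]
  have hlz := Real.log_pos hz1
  have hlw := Real.log_pos hw1
  have hlz' : Real.log (stripMap z).im < 4 * Real.pi := by
    rwa [Real.log_lt_iff_lt_exp (by linarith)]
  have hlw' : Real.log (stripMap w).im < 4 * Real.pi := by
    rwa [Real.log_lt_iff_lt_exp (by linarith)]
  have hpi := Real.pi_pos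
  have hn0 : n = 0 := by
    have habs : -1 < (n : ℝ) ∧ (n : ℝ) < 1 := by
      by_cases hlt : Real.log (stripMap z).im < 2 * Real.pi
      · have hlt' := hzw.1 hlt
        constructor <;> nlinarith
      · have hlt' := mt hzw.2 hlt
        push Not at hlt hlt'
        constructor <;> nlinarith
    have h1 : -1 < n := by exact_mod_cast habs.1
    have h2 : n < 1 := by exact_mod_cast habs.2
    omega
  refine stripMap_injOn hz hw ?_
  simpa [hn0] using hstrip

lemma exists_annulusMap_eq {v : ℂ} (hv1 : Real.exp (-Real.pi) < ‖v‖) (hv2 : ‖v‖ < 1) :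
    ∃ z ∈ unitDisk, annulusMap z = v := by
  have hpi := Real.pi_pos
  have hv0 : 0 < ‖v‖ := (Real.exp_pos _).trans hv1
  have hl1 : Real.log ‖v‖ < 0 := Real.log_neg hv0 hv2
  have hl2 : -Real.pi < Real.log ‖v‖ := (Real.lt_log_iff_exp_lt hv0).2 hv1
  have hsin : 0 < Real.sin (-Real.log ‖v‖) := Real.sin_pos_of_pos_of_lt_pi (by linarith) (by linarith)
  set t := v.arg + Real.log (Real.sin (-Real.log ‖v‖)) with ht
  obtain ⟨n, hn1, hn2⟩ : ∃ n : ℤ, 0 < t + 2 * Real.pi * n ∧ t + 2 * Real.pi * n < 4 * Real.pi := by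
    refine ⟨1 - ⌊t / (2 * Real.pi)⌋, ?_⟩
    have h1 := Int.floor_le (t / (2 * Real.pi))
    have h2 := Int.lt_floor_add_one (t / (2 * Real.pi))
    rw [le_div_iff₀ (by positivity)] at h1
    rw [div_lt_iff₀ (by positivity)] at h2
    push_cast
    constructor <;> nlinarith
  set s : ℂ := ((v.arg + 2 * Real.pi * n : ℝ) : ℂ) + ((-Real.log ‖v‖ : ℝ) : ℂ) * I with hs
  have hsim : s.im = -Real.log ‖v‖ := by simp [hs]
  have hsre : s.re = v.arg + 2 * Real.pi * n := by simp [hs]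
  have him : (exp s).im = Real.exp (t + 2 * Real.pi * n) := by
    rw [Complex.exp_im, hsim, hsre, ht, add_right_comm, Real.exp_add _ (Real.log _),
      Real.exp_log hsin]
  obtain ⟨z, hz, hzs⟩ := exists_stripMap_eq (s := exp s) (by
    rw [him]
    exact ⟨Real.one_lt_exp_iff.2 hn1, Real.exp_lt_exp.2 hn2⟩)
  refine ⟨z, hz, ?_⟩
  rw [annulusMap, hzs, Complex.log_exp (by rw [hsim]; linarith) (by rw [hsim]; linarith)]
  have : s * I = log v + n * (2 * Real.pi * I) := by
    rw [hs, Complex.log]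
    push_cast
    linear_combination -(Real.log ‖v‖ : ℂ) * Complex.I_mul_I
  rw [this, Complex.exp_periodic.int_mul n, Complex.exp_log (norm_pos_iff.1 hv0)]

lemma two_sub_ne_zero_of_mem {v : ℂ} (hv : v ∈ unitDisk) : 2 - v ≠ 0 := by
  intro h
  rw [mem_unitDisk, ← sub_eq_zero.1 h] at hv
  norm_num at hv

lemma norm_two_sub_sq_mul (v : ℂ) (hv : v ∈ unitDisk) :
    ‖2 - v‖ ^ 2 * (1 - ‖diskAut v‖ ^ 2) = 3 * (1 - ‖v‖ ^ 2) := by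
  have h : ‖2 - v‖ ^ 2 ≠ 0 := by simpa using two_sub_ne_zero_of_mem hv
  rw [diskAut, norm_div, div_pow, mul_sub, mul_div_cancel₀ _ h]
  simp only [Complex.sq_norm, Complex.normSq_apply, Complex.sub_re, Complex.sub_im, Complex.mul_re,
    Complex.mul_im, Complex.re_ofNat, Complex.im_ofNat, Complex.one_re, Complex.one_im]
  ring

lemma norm_diskAut_sq_le {v : ℂ} (hv : v ∈ unitDisk) :
    ‖diskAut v‖ ^ 2 ≤ 1 - (1 - ‖v‖ ^ 2) / 3 := by
  have hv1 := mem_unitDisk.1 hv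
  have h := norm_two_sub_sq_mul v hv
  have h3 : ‖2 - v‖ ≤ 3 := (norm_sub_le _ _).trans (by norm_num; linarith)
  have hpos : 0 < ‖2 - v‖ := norm_pos_iff.2 (two_sub_ne_zero_of_mem hv)
  have hv2 : 0 < 1 - ‖v‖ ^ 2 := by nlinarith [norm_nonneg v]
  have h0 : 0 < 1 - ‖diskAut v‖ ^ 2 := by
    by_contra! hneg
    nlinarith [mul_nonneg_of_nonpos_of_nonpos hneg (neg_nonpos.2 (sq_nonneg ‖2 - v‖))]
  nlinarith [mul_le_mul_of_nonneg_right (pow_le_pow_left₀ hpos.le h3 2) h0.le]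

lemma diskAut_mapsTo : Set.MapsTo diskAut unitDisk unitDisk := by
  intro v hv
  have h := norm_diskAut_sq_le hv
  have hv1 := mem_unitDisk.1 hv
  rw [mem_unitDisk]
  nlinarith [norm_nonneg v, norm_nonneg (diskAut v)]

lemma diskAut_injOn : Set.InjOn diskAut unitDisk := by
  intro v hv w hw h
  rw [diskAut, diskAut,
    div_eq_div_iff (two_sub_ne_zero_of_mem hv) (two_sub_ne_zero_of_mem hw)] at h
  linear_combination h / 3

lemma differentiableOn_diskAut : DifferentiableOn ℂ diskAut unitDisk :=
  DifferentiableOn.div (by fun_prop) (by fun_prop) fun _ hv => two_sub_ne_zero_of_mem hv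

lemma exists_diskAut_eq {s : ℂ} (hs : s ∈ unitDisk) (hre : 0 ≤ s.re) :
    ∃ v, 1 / 2 ≤ ‖v‖ ∧ ‖v‖ < 1 ∧ diskAut v = s := by
  have hs1 : s.re * s.re + s.im * s.im < 1 := by
    rw [← Complex.normSq_apply, ← Complex.sq_norm]
    have := mem_unitDisk.1 hs
    nlinarith [norm_nonneg s]
  have hne : 2 + s ≠ 0 := fun h => by
    have := congrArg Complex.re h
    simp at this
    linarith
  have hpos : 0 < ‖2 + s‖ := norm_pos_iff.2 hne
  refine ⟨(1 + 2 * s) / (2 + s), ?_, ?_, ?_⟩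
  · rw [norm_div, le_div_iff₀ hpos]
    refine le_of_sq_le_sq ?_ (norm_nonneg _)
    rw [mul_pow]
    simp only [Complex.sq_norm, Complex.normSq_apply, Complex.add_re, Complex.add_im,
      Complex.mul_re, Complex.mul_im, Complex.re_ofNat, Complex.im_ofNat, Complex.one_re,
      Complex.one_im]
    nlinarith [mul_self_nonneg s.re, mul_self_nonneg s.im]
  · rw [norm_div, div_lt_one hpos]
    refine lt_of_pow_lt_pow_left₀ 2 (norm_nonneg _) ?_
    simp only [Complex.sq_norm, Complex.normSq_apply, Complex.add_re, Complex.add_im,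
      Complex.mul_re, Complex.mul_im, Complex.re_ofNat, Complex.im_ofNat, Complex.one_re,
      Complex.one_im]
    nlinarith
  · have h1 : 2 * ((1 + 2 * s) / (2 + s)) - 1 = 3 * s / (2 + s) := by field_simp; ring
    have h2 : 2 - (1 + 2 * s) / (2 + s) = 3 / (2 + s) := by field_simp; ring
    rw [diskAut, h1, h2]
    field_simp

lemma annulusMap_mapsTo : Set.MapsTo annulusMap unitDisk unitDisk := fun _ hz =>
  mem_unitDisk.2 (norm_annulusMap_lt_one hz)

lemma spiralSymbol_mapsTo : Set.MapsTo spiralSymbol unitDisk unitDisk := fun z hz => by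
  rw [mem_unitDisk, spiralSymbol, norm_pow]
  exact pow_lt_one₀ (norm_nonneg _) (mem_unitDisk.1 (diskAut_mapsTo (annulusMap_mapsTo hz)))
    two_ne_zero

lemma differentiableOn_spiralSymbol : DifferentiableOn ℂ spiralSymbol unitDisk :=
  (differentiableOn_diskAut.comp differentiableOn_annulusMap annulusMap_mapsTo).pow 2

lemma exp_neg_pi_lt_half : Real.exp (-Real.pi) < 1 / 2 := by
  rw [Real.exp_neg, one_div, inv_lt_inv₀ (Real.exp_pos _) two_pos]
  linarith [Real.add_one_le_exp Real.pi, Real.pi_gt_three]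

lemma spiralSymbol_image : spiralSymbol '' unitDisk = unitDisk := by
  refine Set.Subset.antisymm spiralSymbol_mapsTo.image_subset fun w hw => ?_
  obtain ⟨s, hs, hre⟩ : ∃ s : ℂ, s ^ 2 = w ∧ 0 ≤ s.re := by
    obtain ⟨s, hs⟩ := IsAlgClosed.exists_pow_nat_eq w (n := 2) two_pos
    rcases le_total 0 s.re with h | h
    · exact ⟨s, hs, h⟩
    · exact ⟨-s, by rw [neg_sq, hs], by simpa using h⟩
  have hsD : s ∈ unitDisk := by
    rw [mem_unitDisk] at hw ⊢
    rw [← hs, norm_pow] at hw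
    exact (sq_lt_one_iff₀ (norm_nonneg s)).1 hw
  obtain ⟨v, hv1, hv2, hvs⟩ := exists_diskAut_eq hsD hre
  obtain ⟨z, hz, hzv⟩ := exists_annulusMap_eq (exp_neg_pi_lt_half.trans_le hv1) hv2
  exact ⟨z, hz, by rw [spiralSymbol, hzv, hvs, hs]⟩

lemma spiralSymbol_valent : Valent spiralSymbol 4 := by
  classical
  intro w _
  obtain ⟨s, hs⟩ := IsAlgClosed.exists_pow_nat_eq w (n := 2) two_pos
  have hinj : Set.InjOn (fun z => (decide (diskAut (annulusMap z) = s),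
      decide (Real.log (stripMap z).im < 2 * Real.pi))) (unitDisk ∩ spiralSymbol ⁻¹' {w}) := by
    rintro z ⟨hz, hzw⟩ z' ⟨hz', hzw'⟩ h
    simp only [Prod.mk.injEq, decide_eq_decide] at h
    have h1 : diskAut (annulusMap z) = s ∨ diskAut (annulusMap z) = -s :=
      sq_eq_sq_iff_eq_or_eq_neg.1 (hs ▸ hzw)
    have h2 : diskAut (annulusMap z') = s ∨ diskAut (annulusMap z') = -s :=
      sq_eq_sq_iff_eq_or_eq_neg.1 (hs ▸ hzw')
    refine annulusMap_eq_imp hz hz' (diskAut_injOn (annulusMap_mapsTo hz) (annulusMap_mapsTo hz')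
      ?_) h.2
    by_cases hc : diskAut (annulusMap z) = s
    · rw [hc, h.1.1 hc]
    · rw [h1.resolve_left hc, h2.resolve_left (mt h.1.2 hc)]
  calc (unitDisk ∩ spiralSymbol ⁻¹' {w}).encard
      ≤ (Set.univ : Set (Bool × Bool)).encard :=
        Set.encard_le_encard_of_injOn (Set.mapsTo_univ _ _) hinj
    _ = (4 : ℕ) := by rw [Set.encard_univ, ENat.card_eq_coe_fintype_card]; rfl

lemma isSymbol_spiralSymbol : IsSymbol spiralSymbol where
  mapsTo := spiralSymbol_mapsTo
  diff := differentiableOn_spiralSymbol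
  nonconst := by
    rintro ⟨c, hc⟩
    have h : ∀ w ∈ unitDisk, w = c := fun w hw => by
      rw [← spiralSymbol_image] at hw
      obtain ⟨z, hz, rfl⟩ := hw
      exact hc hz
    have h2 : (1 / 2 : ℂ) ∈ unitDisk := by rw [mem_unitDisk]; norm_num
    have := (h _ h2).trans (h _ zero_mem_unitDisk).symm
    norm_num at this

lemma norm_spiralSymbol_le {z : ℂ} (hz : z ∈ unitDisk) :
    ‖spiralSymbol z‖ ≤ Real.exp (-(2 / 9 * ‖stripMap z‖⁻¹)) := by
  set y := ‖stripMap z‖⁻¹ with hy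
  have hy0 : 0 < y := inv_pos.2 (norm_pos_iff.2 (stripMap_ne_zero hz))
  have hy1 : y ≤ 1 := inv_le_one_of_one_le₀ (one_lt_norm_stripMap hz).le
  have hexp : Real.exp (-(2 * y)) ≤ 1 - 2 * y / 3 := by
    rw [Real.exp_neg, inv_le_comm₀ (Real.exp_pos _) (by linarith)]
    refine le_trans ?_ (Real.add_one_le_exp (2 * y))
    rw [inv_le_iff_one_le_mul₀ (by linarith)]
    nlinarith
  have hv : ‖annulusMap z‖ ^ 2 ≤ 1 - 2 * y / 3 := by
    refine (pow_le_pow_left₀ (norm_nonneg _) (norm_annulusMap_le hz) 2).trans ?_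
    rw [← Real.exp_nat_mul]
    refine le_trans (le_of_eq ?_) hexp
    rw [hy]
    push_cast
    ring_nf
  calc ‖spiralSymbol z‖ = ‖diskAut (annulusMap z)‖ ^ 2 := norm_pow _ _
    _ ≤ 1 - (1 - ‖annulusMap z‖ ^ 2) / 3 := norm_diskAut_sq_le (annulusMap_mapsTo hz)
    _ ≤ -(2 / 9 * y) + 1 := by linarith
    _ ≤ _ := Real.add_one_le_exp _

lemma exp_abs_le_re {z : ℂ} (hz : z ∈ unitDisk) :
    Real.exp (|(diskLog z).re| / 2) ≤ 2 * (exp (diskLog z / 2) + exp (-(diskLog z / 2))).re := by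
  set x := (diskLog z).re with hx
  have him := abs_lt.1 (abs_diskLog_im_lt hz)
  have hcos : 1 / 2 ≤ Real.cos ((diskLog z).im / 2) := by
    rw [← Real.cos_pi_div_three, ← Real.cos_abs ((diskLog z).im / 2)]
    have habs : |(diskLog z).im / 2| ≤ Real.pi / 3 := by
      rw [abs_le]
      constructor <;> linarith [Real.pi_pos]
    exact Real.cos_le_cos_of_nonneg_of_le_pi (abs_nonneg _) (by linarith [Real.pi_pos]) habs
  have hre : (diskLog z / 2).re = x / 2 := by simp [hx]
  have him2 : (diskLog z / 2).im = (diskLog z).im / 2 := by simp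
  rw [Complex.add_re, Complex.exp_re, Complex.exp_re, Complex.neg_re, Complex.neg_im, Real.cos_neg,
    hre, him2]
  have h1 := Real.exp_pos (x / 2)
  have h2 := Real.exp_pos (-(x / 2))
  have h3 : Real.exp (|x| / 2) ≤ Real.exp (x / 2) + Real.exp (-(x / 2)) := by
    rcases abs_choice x with h | h <;> rw [h]
    · linarith
    · rw [neg_div]; linarith
  nlinarith

/-- Powers of `stripMap` have harmonic majorants. -/
lemma exists_norm_stripMap_pow_le (N : ℕ) : ∃ C : ℝ, ∀ z ∈ unitDisk,
    ‖stripMap z‖ ^ N ≤ C * (exp (diskLog z / 2) + exp (-(diskLog z / 2))).re := by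
  have hc := stripMap_slope_pos
  set c := (Real.exp (4 * Real.pi) - 1) / Real.pi with hcdef
  set m := (1 + Real.exp (4 * Real.pi)) / 2 with hm
  have hm0 : 0 < m := by positivity
  refine ⟨(2 * c) ^ N * N.factorial * Real.exp ((2 * c + m) / (2 * c)) * 2, fun z hz => ?_⟩
  have hnorm : ‖stripMap z‖ ≤ c * |(diskLog z).re| + (2 * c + m) := by
    have h1 : ‖diskLog z‖ ≤ |(diskLog z).re| + 2 := by
      refine (Complex.norm_le_abs_re_add_abs_im _).trans ?_
      linarith [abs_diskLog_im_lt hz, Real.pi_le_four]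
    calc ‖stripMap z‖ ≤ ‖(c : ℂ) * diskLog z‖ + ‖(m : ℂ) * I‖ := norm_add_le _ _
      _ = c * ‖diskLog z‖ + m := by
        rw [norm_mul, norm_mul, Complex.norm_I, mul_one, Complex.norm_of_nonneg hc.le,
          Complex.norm_of_nonneg hm0.le]
      _ ≤ _ := by nlinarith
  set Y := c * |(diskLog z).re| + (2 * c + m) with hY
  have hY0 : 0 ≤ Y := (norm_nonneg _).trans hnorm
  have hexp := Real.pow_div_factorial_le_exp (Y / (2 * c)) (by positivity) N
  rw [div_le_iff₀ (by positivity), div_pow, div_le_iff₀ (by positivity)] at hexp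
  have hsplit : Real.exp (Y / (2 * c)) =
      Real.exp (|(diskLog z).re| / 2) * Real.exp ((2 * c + m) / (2 * c)) := by
    rw [← Real.exp_add, hY]
    congr 1
    field_simp
  calc ‖stripMap z‖ ^ N ≤ Y ^ N := pow_le_pow_left₀ (norm_nonneg _) hnorm N
    _ ≤ Real.exp (Y / (2 * c)) * N.factorial * (2 * c) ^ N := hexp
    _ = (2 * c) ^ N * N.factorial * Real.exp ((2 * c + m) / (2 * c)) *
          Real.exp (|(diskLog z).re| / 2) := by rw [hsplit]; ring
    _ ≤ (2 * c) ^ N * N.factorial * Real.exp ((2 * c + m) / (2 * c)) *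
          (2 * (exp (diskLog z / 2) + exp (-(diskLog z / 2))).re) := by
        gcongr
        exact exp_abs_le_re hz
    _ = _ := by ring

lemma pow_mul_norm_spiralSymbol_pow_le {z : ℂ} (hz : z ∈ unitDisk) (N k : ℕ) :
    ((k : ℝ) + 1) ^ N * ‖spiralSymbol z‖ ^ (2 * k) ≤
      Real.exp 1 * N.factorial * (9 / 4) ^ N * ‖stripMap z‖ ^ N := by
  have hL := one_lt_norm_stripMap hz
  set x := 4 / 9 * ‖stripMap z‖⁻¹ with hx
  have hx0 : 0 < x := by positivity
  have hx1 : x ≤ 1 := by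
    have := inv_le_one_of_one_le₀ hL.le
    linarith
  have h1 : ‖spiralSymbol z‖ ^ (2 * k) ≤ Real.exp 1 * Real.exp (-(((k : ℝ) + 1) * x)) := by
    refine (pow_le_pow_left₀ (norm_nonneg _) (norm_spiralSymbol_le hz) (2 * k)).trans ?_
    rw [← Real.exp_nat_mul, ← Real.exp_add, Real.exp_le_exp]
    have hk : 2 * (k : ℝ) * -(2 / 9 * ‖stripMap z‖⁻¹) = -(k * x) := by rw [hx]; ring
    push_cast
    rw [hk]
    linarith
  have h2 := Real.pow_div_factorial_le_exp (((k : ℝ) + 1) * x) (by positivity) N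
  rw [div_le_iff₀ (by positivity), mul_pow] at h2
  have h3 : x ^ N * ((9 / 4) ^ N * ‖stripMap z‖ ^ N) = 1 := by
    rw [← mul_pow, ← mul_pow, hx]
    have : 4 / 9 * ‖stripMap z‖⁻¹ * (9 / 4 * ‖stripMap z‖) = 1 := by field_simp
    rw [this, one_pow]
  set Q := (9 / 4 : ℝ) ^ N * ‖stripMap z‖ ^ N with hQ
  have hQ0 : 0 ≤ Q := by positivity
  set e := Real.exp (((k : ℝ) + 1) * x) with he
  have hee : e * Real.exp (-(((k : ℝ) + 1) * x)) = 1 := by rw [he, ← Real.exp_add]; simp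
  calc ((k : ℝ) + 1) ^ N * ‖spiralSymbol z‖ ^ (2 * k)
      ≤ ((k : ℝ) + 1) ^ N * (Real.exp 1 * Real.exp (-(((k : ℝ) + 1) * x))) := by gcongr
    _ = (((k : ℝ) + 1) ^ N * x ^ N) * Q * (Real.exp 1 * Real.exp (-(((k : ℝ) + 1) * x))) := by
        rw [mul_assoc _ (x ^ N), h3, mul_one]
    _ ≤ (e * N.factorial) * Q * (Real.exp 1 * Real.exp (-(((k : ℝ) + 1) * x))) := by gcongr
    _ = (e * Real.exp (-(((k : ℝ) + 1) * x))) * (Real.exp 1 * N.factorial * Q) := by ring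
    _ = _ := by rw [hee, hQ]; ring

lemma exists_majorant_spiralSymbol (N : ℕ) : ∃ G : ℂ → ℂ, DifferentiableOn ℂ G unitDisk ∧
    ∀ z ∈ unitDisk, ∀ k : ℕ,
      ((k : ℝ) + 1) ^ N * ‖spiralSymbol z‖ ^ (2 * k) ≤ (G z).re := by
  obtain ⟨C, hC⟩ := exists_norm_stripMap_pow_le N
  have hd := differentiableOn_diskLog
  refine ⟨fun z => ((Real.exp 1 * N.factorial * (9 / 4) ^ N * C : ℝ) : ℂ) *
    (exp (diskLog z / 2) + exp (-(diskLog z / 2))), by fun_prop, fun z hz k => ?_⟩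
  refine (pow_mul_norm_spiralSymbol_pow_le hz N k).trans ?_
  rw [Complex.re_ofReal_mul, mul_assoc _ C]
  gcongr
  exact hC z hz

/-- there is a surjective four-valent symbol `ψ` whose composition
operator on `H²` lies in every Schatten class `S_p`, `p > 0`. -/
theorem stmt_1 :
    ∃ ψ : ℂ → ℂ, IsSymbol ψ ∧ ψ '' unitDisk = unitDisk ∧ Valent ψ 4 ∧
      ∃ T : H2 →L[ℂ] H2, IsCompOp ψ T ∧
        ∀ p : ℝ, 0 < p → Summable (fun n : ℕ => approxNum (n + 1) T ^ p) := by
  exact ⟨spiralSymbol, isSymbol_spiralSymbol, spiralSymbol_image, spiralSymbol_valent,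
    exists_isCompOp_summable differentiableOn_spiralSymbol spiralSymbol_mapsTo
      exists_majorant_spiralSymbol⟩

end
end

section
/- For every symbol φ: D → D there exist constants δ > 0 and a > 0 such that a_n(C_φ) ≥ δ e^{−a n} for all n ≥ 1. -/
open Complex MeasureTheory Set Filter
open scoped ENNReal Topology

noncomputable section

lemma H2.norm_term_le (a : H2) (z : ℂ) (n : ℕ) : ‖a n * z ^ n‖ ≤ ‖a‖ * ‖z‖ ^ n := by
  rw [norm_mul, norm_pow]
  gcongr
  exact lp.norm_apply_le_norm (by norm_num) a n

lemma H2.summable_eval (a : H2) {z : ℂ} (hz : ‖z‖ < 1) : Summable fun n => a n * z ^ n :=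
  .of_norm_bounded ((summable_geometric_of_lt_one (norm_nonneg z) hz).mul_left ‖a‖)
    (H2.norm_term_le a z)

lemma H2.norm_eval_le (a : H2) {z : ℂ} (hz : ‖z‖ < 1) : ‖H2.eval a z‖ ≤ ‖a‖ * (1 - ‖z‖)⁻¹ :=
  tsum_of_norm_bounded ((hasSum_geometric_of_lt_one (norm_nonneg z) hz).mul_left ‖a‖)
    (H2.norm_term_le a z)

/-- Evaluation at a point of the disk, as a linear functional. -/
def H2.evalLM (z : ℂ) (hz : ‖z‖ < 1) : H2 →ₗ[ℂ] ℂ where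
  toFun a := H2.eval a z
  map_add' a b := by
    simp only [H2.eval, lp.coeFn_add, Pi.add_apply, add_mul]
    exact (H2.summable_eval a hz).tsum_add (H2.summable_eval b hz)
  map_smul' c a := by
    simp only [H2.eval, lp.coeFn_smul, Pi.smul_apply, smul_eq_mul, mul_assoc, tsum_mul_left,
      RingHom.id_apply]

@[simp]
lemma H2.evalLM_apply (z : ℂ) (hz : ‖z‖ < 1) (a : H2) : H2.evalLM z hz a = H2.eval a z := rfl

lemma H2.eval_single (j : ℕ) (c z : ℂ) :
    H2.eval (lp.single 2 j c : H2) z = c * z ^ j := by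
  rw [H2.eval, tsum_eq_single j]
  · rw [lp.single_apply_self]
  · intro i hi
    rw [lp.single_apply_ne _ _ _ hi, zero_mul]

/-- The function `z ↦ (z - c) ^ k` as an element of `H²`. -/
def H2.shiftedMonomial (c : ℂ) (k : ℕ) : H2 :=
  ∑ m ∈ Finset.range (k + 1), lp.single 2 m ((-c) ^ (k - m) * (k.choose m : ℂ))

lemma H2.norm_shiftedMonomial_le (c : ℂ) (k : ℕ) :
    ‖H2.shiftedMonomial c k‖ ≤ (1 + ‖c‖) ^ k := by
  rw [H2.shiftedMonomial, add_pow]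
  refine (norm_sum_le _ _).trans (Finset.sum_le_sum fun m _ => ?_)
  rw [lp.norm_single (by norm_num)]
  simp

lemma H2.eval_shiftedMonomial (c : ℂ) (k : ℕ) {z : ℂ} (hz : ‖z‖ < 1) :
    H2.eval (H2.shiftedMonomial c k) z = (z - c) ^ k := by
  rw [← H2.evalLM_apply z hz, H2.shiftedMonomial, map_sum, sub_eq_add_neg, add_pow]
  refine Finset.sum_congr rfl fun m _ => ?_
  rw [H2.evalLM_apply, H2.eval_single]
  ring

lemma Polynomial.iterate_deriv_eval (p : Polynomial ℂ) (k : ℕ) :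
    deriv^[k] (fun x => p.eval x) = fun x => (Polynomial.derivative^[k] p).eval x := by
  induction k generalizing p with
  | zero => rfl
  | succ k ih =>
    have h : deriv (fun x => p.eval x) = fun x => p.derivative.eval x := by
      funext x
      exact p.deriv
    rw [Function.iterate_succ_apply, h, ih, Function.iterate_succ_apply]

/-- Cauchy's estimate for the coefficients of a polynomial. -/
lemma Polynomial.norm_coeff_le (p : Polynomial ℂ) {r M : ℝ} (hr : 0 < r)
    (hM : ∀ z : ℂ, ‖z‖ = r → ‖p.eval z‖ ≤ M) (k : ℕ) : ‖p.coeff k‖ ≤ M / r ^ k := by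
  have h := norm_iteratedDeriv_le_of_forall_mem_sphere_norm_le (c := 0) (C := M) k hr
    (f := fun x => p.eval x) p.differentiable.diffContOnCl (fun z hz => hM z (by simpa using hz))
  rw [iteratedDeriv_eq_iterate, p.iterate_deriv_eval] at h
  beta_reduce at h
  rw [← Polynomial.coeff_zero_eq_eval_zero,
    Polynomial.coeff_iterate_derivative, zero_add, Nat.descFactorial_self, nsmul_eq_mul, norm_mul,
    Complex.norm_natCast, mul_div_assoc] at h
  exact le_of_mul_le_mul_left h (by positivity)

lemma sum_pow_le_one_add_pow {x : ℝ} (hx : 1 ≤ x) (n : ℕ) :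
    ∑ k ∈ Finset.range n, x ^ k ≤ (1 + x) ^ n := by
  induction n with
  | zero => simp
  | succ n ih =>
    have h : x ^ n ≤ (1 + x) ^ n := by gcongr; linarith
    have h' : (1 + x) ^ n ≤ x * (1 + x) ^ n := le_mul_of_one_le_left (by positivity) hx
    rw [Finset.sum_range_succ, pow_succ]
    linarith

/-- If `T` is bounded below by `s` on the image of an injective linear map from `ℂⁿ`, then
`s` is a lower bound for the `n`-th approximation number. -/
lemma le_approxNum {E F : Type} [NormedAddCommGroup E] [NormedAddCommGroup F]
    [NormedSpace ℂ E] [NormedSpace ℂ F] {n : ℕ} (hn : 1 ≤ n) (T : E →L[ℂ] F) {s : ℝ}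
    (L : (Fin n → ℂ) →ₗ[ℂ] E) (hL : Function.Injective L)
    (h : ∀ b, s * ‖L b‖ ≤ ‖T (L b)‖) : s ≤ approxNum n T := by
  refine le_csInf ⟨_, 0, by simpa using (show 0 < n from hn), rfl⟩ ?_
  rintro _ ⟨R, hR, rfl⟩
  obtain ⟨b, hb, hb0⟩ : ∃ b, R (L b) = 0 ∧ b ≠ 0 := by
    by_contra! hcon
    have hinj : Function.Injective (((R : E →ₗ[ℂ] F).rangeRestrict).comp L) := by
      rw [injective_iff_map_eq_zero]
      intro b hb
      exact hcon b (congrArg Subtype.val hb)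
    have := LinearMap.rank_le_of_injective _ hinj
    rw [rank_fin_fun] at this
    exact absurd hR this.not_gt
  have hpos : 0 < ‖L b‖ := norm_pos_iff.2 ((map_ne_zero_iff L hL).2 hb0)
  refine le_of_mul_le_mul_right ((h b).trans ?_) hpos
  simpa [hb] using (T - R).le_opNorm (L b)

/-- The image of the disk of radius `1/2` under a symbol contains a closed disk centred at
`φ 0`. -/
lemma IsSymbol.exists_closedBall_subset {φ : ℂ → ℂ} (hφ : IsSymbol φ) :
    ∃ r > 0, Metric.closedBall (φ 0) r ⊆ φ '' Metric.ball 0 (1 / 2) := by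
  have hopen : IsOpen (φ '' Metric.ball 0 (1 / 2)) := by
    rcases (hφ.diff.analyticOnNhd Metric.isOpen_ball).is_constant_or_isOpen
      (convex_ball (0 : ℂ) 1).isPreconnected with ⟨w, hw⟩ | h
    · exact absurd ⟨w, hw⟩ hφ.nonconst
    · exact h _ (Metric.ball_subset_ball (by norm_num)) Metric.isOpen_ball
  exact Metric.nhds_basis_closedBall.mem_iff.1
    (hopen.mem_nhds ⟨0, Metric.mem_ball_self (by norm_num), rfl⟩)

/-- for every symbol `φ` there are `δ, a > 0` with
`a_n(C_φ) ≥ δ e^{-a n}` for all `n ≥ 1`. -/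
theorem stmt_2 (φ : ℂ → ℂ) (hφ : IsSymbol φ) (T : H2 →L[ℂ] H2) (hT : IsCompOp φ T) :
    ∃ δ > (0 : ℝ), ∃ a > (0 : ℝ), ∀ n : ℕ, 1 ≤ n →
      δ * Real.exp (-a * n) ≤ approxNum n T := by
  obtain ⟨r, hr, hball⟩ := hφ.exists_closedBall_subset
  set c := φ 0
  have hc : ‖c‖ < 1 := by
    simpa [unitDisk] using hφ.mapsTo (show (0 : ℂ) ∈ unitDisk by simp [unitDisk])
  let A : ℝ := 1 + (1 + 2 / r)
  have hA : 1 < A := by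
    have : 0 < 2 / r := by positivity
    simp only [A]
    linarith
  have hApos : 0 < A := by linarith
  refine ⟨1 / 2, by norm_num, Real.log A, Real.log_pos hA, fun n hn => ?_⟩
  let L : (Fin n → ℂ) →ₗ[ℂ] H2 :=
    Fintype.linearCombination ℂ fun k : Fin n => H2.shiftedMonomial c k
  have hLapply (b : Fin n → ℂ) : L b = ∑ k, b k • H2.shiftedMonomial c k := rfl
  have hcoeff (b : Fin n → ℂ) (k : Fin n) : ‖b k‖ ≤ ‖T (L b)‖ * 2 / r ^ (k : ℕ) := by
    let p : Polynomial ℂ := ∑ k : Fin n, Polynomial.C (b k) * Polynomial.X ^ (k : ℕ)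
    have hp : p.coeff k = b k := by
      simp [p, Polynomial.coeff_X_pow, Fin.val_inj]
    rw [← hp]
    refine p.norm_coeff_le hr (fun u hu => ?_) k
    obtain ⟨z, hz, hzu⟩ := hball (show c + u ∈ Metric.closedBall c r by simp [hu])
    have hz' : ‖z‖ < 1 / 2 := by simpa using hz
    have hz1 : ‖z‖ < 1 := by linarith
    have hzD : z ∈ unitDisk := by simpa [unitDisk] using hz1
    have hφz : ‖φ z‖ < 1 := by simpa [unitDisk] using hφ.mapsTo hzD
    have heq : p.eval u = H2.eval (T (L b)) z := by
      rw [hT _ z hzD, ← H2.evalLM_apply _ hφz, hLapply, map_sum, Polynomial.eval_finsetSum]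
      refine Finset.sum_congr rfl fun j _ => ?_
      rw [map_smul, H2.evalLM_apply, H2.eval_shiftedMonomial c j hφz, hzu]
      simp
    rw [heq]
    refine (H2.norm_eval_le _ hz1).trans ?_
    gcongr
    rw [inv_le_comm₀ (by linarith) (by norm_num)]
    linarith
  refine le_approxNum hn T L ?_ fun b => ?_
  · rw [injective_iff_map_eq_zero]
    intro b hb
    ext k
    simpa [hb] using hcoeff b k
  · have hnorm : ‖L b‖ ≤ ‖T (L b)‖ * 2 * A ^ n := by
      calc ‖L b‖ ≤ ∑ k : Fin n, ‖T (L b)‖ * 2 * (1 + 2 / r) ^ (k : ℕ) := by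
            rw [hLapply b]
            refine (norm_sum_le _ _).trans (Finset.sum_le_sum fun k _ => ?_)
            rw [norm_smul, ← hLapply b]
            calc ‖b k‖ * ‖H2.shiftedMonomial c k‖
                ≤ (‖T (L b)‖ * 2 / r ^ (k : ℕ)) * 2 ^ (k : ℕ) := by
                  gcongr
                  · exact hcoeff b k
                  · refine (H2.norm_shiftedMonomial_le c k).trans ?_
                    gcongr
                    linarith
              _ = ‖T (L b)‖ * 2 * (2 / r) ^ (k : ℕ) := by rw [div_pow]; ring
              _ ≤ ‖T (L b)‖ * 2 * (1 + 2 / r) ^ (k : ℕ) := by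
                  gcongr
                  linarith
        _ = ‖T (L b)‖ * 2 * ∑ k ∈ Finset.range n, (1 + 2 / r) ^ k := by
            rw [← Finset.mul_sum, Fin.sum_univ_eq_sum_range fun k => (1 + 2 / r) ^ k]
        _ ≤ ‖T (L b)‖ * 2 * A ^ n := by
            gcongr
            exact sum_pow_le_one_add_pow (le_add_of_nonneg_right (by positivity)) n
    have hexp : Real.exp (-Real.log A * n) = (A ^ n)⁻¹ := by
      rw [neg_mul, Real.exp_neg, mul_comm, Real.exp_nat_mul, Real.exp_log hApos]
    rw [hexp, mul_assoc, one_div, inv_mul_le_iff₀ (by norm_num),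
      inv_mul_le_iff₀ (by positivity)]
    linarith

end
end

section
/- If a symbol φ: D → D satisfies ‖φ‖_∞ = sup_{z∈D} |φ(z)| = 1, then there exist δ > 0 and a sequence (ε_n) of positive numbers tending to 0 such that a_n(C_φ) ≥ δ e^{−n ε_n} for all n ≥ 1. -/
open Complex MeasureTheory Set Filter
open scoped ENNReal Topology

noncomputable section

namespace H2

lemma norm_term_le_s3 (a : H2) (z : ℂ) (n : ℕ) : ‖a n * z ^ n‖ ≤ ‖a‖ * ‖z‖ ^ n := by
  rw [norm_mul, norm_pow]
  gcongr
  exact lp.norm_apply_le_norm (by norm_num) a n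

lemma summable_eval_s3 (a : H2) {z : ℂ} (hz : ‖z‖ < 1) : Summable fun n : ℕ => a n * z ^ n :=
  Summable.of_norm_bounded ((summable_geometric_of_lt_one (norm_nonneg z) hz).mul_left ‖a‖)
    (norm_term_le_s3 a z)

lemma norm_eval_le_s3 (a : H2) {z : ℂ} (hz : ‖z‖ < 1) : ‖eval a z‖ ≤ ‖a‖ / (1 - ‖z‖) := by
  rw [div_eq_mul_inv]
  exact tsum_of_norm_bounded ((hasSum_geometric_of_lt_one (norm_nonneg z) hz).mul_left ‖a‖)
    (norm_term_le_s3 a z)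

/-- Evaluation at a point of the disk, as a linear functional. -/
def evalLM_s3 (z : ℂ) (hz : ‖z‖ < 1) : H2 →ₗ[ℂ] ℂ where
  toFun a := eval a z
  map_add' a b := by
    simp only [eval, lp.coeFn_add, Pi.add_apply, add_mul]
    exact (summable_eval_s3 a hz).tsum_add (summable_eval_s3 b hz)
  map_smul' c a := by
    simp only [eval, lp.coeFn_smul, Pi.smul_apply, smul_eq_mul, mul_assoc, RingHom.id_apply]
    exact tsum_mul_left

/-- The coefficients of `z ↦ z f(z)`. -/
def shiftCoeff (a : ℕ → ℂ) : ℕ → ℂ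
  | 0 => 0
  | n + 1 => a n

lemma hasSum_norm_sq (a : H2) : HasSum (fun n => ‖a n‖ ^ 2) (‖a‖ ^ 2) := by
  have h := lp.hasSum_norm (p := 2) (by norm_num) a
  simpa using h

lemma hasSum_norm_sq_shiftCoeff (a : H2) :
    HasSum (fun n => ‖shiftCoeff a n‖ ^ 2) (‖a‖ ^ 2) := by
  rw [← hasSum_nat_add_iff' 1]
  simpa [shiftCoeff] using hasSum_norm_sq a

/-- The shift `f ↦ z f` on `H²`, as a linear isometry. -/
def shift : H2 →ₗᵢ[ℂ] H2 where
  toFun a := ⟨shiftCoeff a, by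
    refine memℓp_gen ?_
    simpa using (hasSum_norm_sq_shiftCoeff a).summable⟩
  map_add' a b := by
    ext n
    cases n with
    | zero => exact (add_zero (0 : ℂ)).symm
    | succ n => rfl
  map_smul' c a := by
    ext n
    cases n <;> simp [shiftCoeff]
  norm_map' a := by
    refine (sq_eq_sq₀ (norm_nonneg _) (norm_nonneg _)).1 ?_
    exact (hasSum_norm_sq _).unique (hasSum_norm_sq_shiftCoeff a)

lemma eval_shift (a : H2) {z : ℂ} (hz : ‖z‖ < 1) : eval (shift a) z = z * eval a z := by
  have h := (summable_eval_s3 (shift a) hz).tsum_eq_zero_add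
  have h0 : shift a 0 = 0 := rfl
  have h1 : ∀ n, shift a (n + 1) = a n := fun _ => rfl
  simp only [h0, h1, zero_mul, zero_add] at h
  rw [eval, h, eval, ← tsum_mul_left]
  exact tsum_congr fun n => by ring

/-- Multiplication by the Blaschke factor `(z - w) / (1 - conj w * z)` does not increase the norm. -/
lemma exists_blaschke_mul (w : ℂ) (hw : ‖w‖ < 1) (a : H2) :
    ∃ b : H2, ‖b‖ ≤ ‖a‖ ∧ ∀ z : ℂ, ‖z‖ < 1 →
      eval b z = (z - w) / (1 - (starRingEnd ℂ) w * z) * eval a z := by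
  set S : H2 →L[ℂ] H2 := shift.toContinuousLinearMap with hS
  have hSn : ‖(starRingEnd ℂ) w • S‖ < 1 := by
    rw [norm_smul, RCLike.norm_conj]
    have : ‖S‖ ≤ 1 := shift.norm_toContinuousLinearMap_le
    nlinarith [norm_nonneg w, norm_nonneg S]
  obtain ⟨V, hV⟩ := isUnit_one_sub_of_norm_lt_one hSn
  obtain ⟨g, hg⟩ : ∃ g : H2, g - (starRingEnd ℂ) w • shift g = a := by
    refine ⟨(↑V⁻¹ : H2 →L[ℂ] H2) a, ?_⟩
    have h := congrArg (fun X : H2 →L[ℂ] H2 => X a) V.mul_inv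
    simpa [hV, hS] using h
  refine ⟨shift g - w • g, ?_, fun z hz => ?_⟩
  · have h1 : ‖shift g - w • g‖ ^ 2 = ‖a‖ ^ 2 := by
      rw [← hg, norm_sub_sq (𝕜 := ℂ), norm_sub_sq (𝕜 := ℂ), norm_smul, norm_smul,
        RCLike.norm_conj, shift.norm_map, inner_smul_right, inner_smul_right,
        ← inner_conj_symm g (shift g), ← map_mul, RCLike.conj_re]
    exact ((sq_eq_sq₀ (norm_nonneg _) (norm_nonneg _)).1 h1).le
  · have hden : 1 - (starRingEnd ℂ) w * z ≠ 0 := by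
      intro h
      have h2 : ‖(starRingEnd ℂ) w * z‖ = 1 := by
        rw [← sub_eq_zero.1 h, norm_one]
      rw [norm_mul, RCLike.norm_conj] at h2
      nlinarith [norm_nonneg w, norm_nonneg z]
    have e1 : eval (shift g - w • g) z = eval (shift g) z - w * eval g z := by
      have := (evalLM_s3 z hz).map_sub (shift g) (w • g)
      rwa [(evalLM_s3 z hz).map_smul] at this
    have e2 : eval a z = eval g z - (starRingEnd ℂ) w * eval (shift g) z := by
      rw [← hg]
      have := (evalLM_s3 z hz).map_sub g ((starRingEnd ℂ) w • shift g)
      rwa [(evalLM_s3 z hz).map_smul] at this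
    rw [e1, e2, eval_shift g hz, div_mul_eq_mul_div, eq_div_iff hden]
    ring

/-- Finite Blaschke products lie in the unit ball of `H²`. -/
lemma exists_blaschke_prod {ι : Type*} (s : Finset ι) (w : ι → ℂ) (hw : ∀ i, ‖w i‖ < 1) :
    ∃ b : H2, ‖b‖ ≤ 1 ∧ ∀ z : ℂ, ‖z‖ < 1 →
      eval b z = ∏ i ∈ s, (z - w i) / (1 - (starRingEnd ℂ) (w i) * z) := by
  classical
  induction s using Finset.induction_on with
  | empty =>
    refine ⟨lp.single 2 0 1, ?_, fun z _ => ?_⟩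
    · rw [lp.norm_single (by norm_num)]
      simp
    · rw [eval, tsum_eq_single 0]
      · simp
      · intro n hn
        simp [hn]
  | insert i s hi ih =>
    obtain ⟨b, hb, hbz⟩ := ih
    obtain ⟨c, hc, hcz⟩ := exists_blaschke_mul (w i) (hw i) b
    refine ⟨c, hc.trans hb, fun z hz => ?_⟩
    rw [hcz z hz, hbz z hz, Finset.prod_insert hi]

end H2

/-- The pseudo-hyperbolic distance decreases under `z ↦ |z|`. -/
lemma abs_sub_mul_norm_le (a b : ℂ) (ha : ‖a‖ < 1) (hb : ‖b‖ < 1) :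
    |‖a‖ - ‖b‖| * ‖1 - (starRingEnd ℂ) a * b‖ ≤ ‖b - a‖ * ((1 - ‖a‖) + (1 - ‖b‖)) := by
  have key : ‖1 - (starRingEnd ℂ) a * b‖ ^ 2 =
      ‖b - a‖ ^ 2 + (1 - ‖a‖ ^ 2) * (1 - ‖b‖ ^ 2) := by
    simp only [Complex.sq_norm, Complex.normSq_apply, Complex.sub_re, Complex.sub_im,
      Complex.mul_re, Complex.mul_im, Complex.conj_re, Complex.conj_im, Complex.one_re,
      Complex.one_im]
    ring
  have hd : |‖a‖ - ‖b‖| ≤ ‖b - a‖ := by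
    rw [norm_sub_rev]
    exact abs_norm_sub_norm_le a b
  have hna := norm_nonneg a
  have hnb := norm_nonneg b
  have h1 : |‖a‖ - ‖b‖| * ‖1 - (starRingEnd ℂ) a * b‖ ≤ ‖b - a‖ * (1 - ‖a‖ * ‖b‖) := by
    have hab : 0 ≤ 1 - ‖a‖ * ‖b‖ := by nlinarith
    refine (sq_le_sq₀ (by positivity) (by positivity)).1 ?_
    rw [mul_pow, mul_pow, key, sq_abs]
    have hd2 : (‖a‖ - ‖b‖) ^ 2 ≤ ‖b - a‖ ^ 2 := by
      rw [← sq_abs (‖a‖ - ‖b‖)]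
      gcongr
    have hP : 0 ≤ (1 - ‖a‖ ^ 2) * (1 - ‖b‖ ^ 2) :=
      mul_nonneg (by nlinarith) (by nlinarith)
    nlinarith [mul_le_mul_of_nonneg_right hd2 hP]
  refine h1.trans (mul_le_mul_of_nonneg_left ?_ (norm_nonneg _))
  nlinarith

lemma exp_neg_two_sqrt_le {r s : ℝ} (hs : 0 < s) (hr : 1 + s ≤ r) :
    Real.exp (-(2 * √(2 / s))) ≤ (r - 1) / (r + 1) := by
  have h0 : (0 : ℝ) ≤ √(2 / s) := Real.sqrt_nonneg _
  have h1 : 1 + 2 / s ≤ Real.exp (2 * √(2 / s)) := by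
    have h2 : √(2 / s) ^ 2 = 2 / s := Real.sq_sqrt (by positivity)
    have h3 : 1 + √(2 / s) ≤ Real.exp (√(2 / s)) := by
      linarith [Real.add_one_le_exp (√(2 / s))]
    rw [two_mul, Real.exp_add]
    nlinarith
  rw [Real.exp_neg]
  have h4 : (1 + 2 / s)⁻¹ ≤ (r - 1) / (r + 1) := by
    have h5 : (1 + 2 / s)⁻¹ = s / (s + 2) := by field_simp
    rw [h5, div_le_div_iff₀ (by positivity) (by linarith)]
    nlinarith
  exact (inv_anti₀ (by positivity) h1).trans h4

lemma sum_one_div_sqrt_le (n : ℕ) :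
    ∑ k ∈ Finset.range (n + 1), 1 / √(k : ℝ) ≤ 2 * √(n : ℝ) := by
  induction n with
  | zero => simp
  | succ n ih =>
    rw [Finset.sum_range_succ]
    have ha : 0 ≤ √(n : ℝ) := Real.sqrt_nonneg _
    have hb : 0 < √((n + 1 : ℕ) : ℝ) := Real.sqrt_pos.2 (by positivity)
    have hab : √(n : ℝ) ≤ √((n + 1 : ℕ) : ℝ) := Real.sqrt_le_sqrt (by push_cast; linarith)
    have ha2 : √(n : ℝ) ^ 2 = n := Real.sq_sqrt (by positivity)
    have hb2 : √((n + 1 : ℕ) : ℝ) ^ 2 = n + 1 := by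
      rw [Real.sq_sqrt (by positivity)]; push_cast; ring
    have : 1 / √((n + 1 : ℕ) : ℝ) ≤ 2 * (√((n + 1 : ℕ) : ℝ) - √(n : ℝ)) := by
      rw [div_le_iff₀ hb]
      nlinarith [sq_nonneg (√((n + 1 : ℕ) : ℝ) - √(n : ℝ))]
    linarith

lemma sum_dist_le_two_mul_sum {g : ℕ → ℝ} (hg : ∀ k, 0 ≤ g k) {n j : ℕ} (hj : j < n) :
    ∑ i ∈ Finset.range n, g (Nat.dist i j) ≤ 2 * ∑ k ∈ Finset.range n, g k := by
  rw [← Finset.sum_range_add_sum_Ico _ hj, two_mul]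
  refine add_le_add ?_ ?_
  · rw [← Finset.sum_range_reflect]
    calc _ = ∑ k ∈ Finset.range (j + 1), g k := by
          refine Finset.sum_congr rfl fun k hk => ?_
          have := Finset.mem_range.1 hk
          congr 1
          unfold Nat.dist
          omega
      _ ≤ _ := Finset.sum_le_sum_of_subset_of_nonneg
          (Finset.range_subset_range.2 hj) fun _ _ _ => hg _
  · calc _ = ∑ i ∈ Finset.Ico (j + 1) n, g (i - j) := by
          refine Finset.sum_congr rfl fun k hk => ?_
          have := Finset.mem_Ico.1 hk
          congr 1
          unfold Nat.dist
          omega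
      _ = ∑ k ∈ Finset.Ico 1 (n - j), g k := by
          rw [Finset.sum_Ico_eq_sum_range, Finset.sum_Ico_eq_sum_range]
          refine Finset.sum_congr (by congr 1) fun k _ => ?_
          congr 1
          omega
      _ ≤ _ := by
          refine Finset.sum_le_sum_of_subset_of_nonneg (fun k hk => ?_) fun _ _ _ => hg _
          have := Finset.mem_Ico.1 hk
          exact Finset.mem_range.2 (by omega)

/-- Points whose distances to the circle are in geometric progression are pseudo-hyperbolically
well separated. -/
lemma exp_le_prod_norm_blaschke {n : ℕ} {τ x₀ : ℝ} (hτ : 0 < τ) (hx₀ : 0 < x₀) (w : Fin n → ℂ)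
    (hw : ∀ i, ‖w i‖ < 1) (hwx : ∀ i, 1 - ‖w i‖ = x₀ / (1 + τ) ^ (i : ℕ)) (j : Fin n) :
    Real.exp (-(8 * √(2 / τ) * √(n : ℝ))) ≤
      ‖∏ i ∈ Finset.univ.erase j, (w j - w i) / (1 - (starRingEnd ℂ) (w i) * w j)‖ := by
  have pair_lt : ∀ i k : Fin n, (i : ℕ) < k →
      Real.exp (-(2 * √(2 / (((k : ℕ) - (i : ℕ) : ℕ) * τ)))) ≤
        |‖w i‖ - ‖w k‖| / ((1 - ‖w i‖) + (1 - ‖w k‖)) := by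
    intro i k hik
    obtain ⟨d, hd⟩ := Nat.exists_eq_add_of_lt hik
    have hsub : (k : ℕ) - (i : ℕ) = d + 1 := by omega
    rw [hsub]
    have hr := one_add_mul_le_pow (a := τ) (by linarith) (d + 1)
    refine (exp_neg_two_sqrt_le (by positivity) hr).trans (le_of_eq ?_)
    have hi : x₀ / (1 + τ) ^ (i : ℕ) = (1 + τ) ^ (d + 1) * (x₀ / (1 + τ) ^ (k : ℕ)) := by
      rw [hd, add_assoc, pow_add _ (i : ℕ)]
      field_simp
    have hk : 0 < x₀ / (1 + τ) ^ (k : ℕ) := by positivity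
    have hdiff : ‖w i‖ - ‖w k‖ = -(((1 + τ) ^ (d + 1) - 1) * (x₀ / (1 + τ) ^ (k : ℕ))) := by
      linarith [hwx i, hwx k]
    have h1 : 0 ≤ (1 + τ) ^ (d + 1) - 1 := by
      have : 0 ≤ ((d + 1 : ℕ) : ℝ) * τ := by positivity
      linarith
    rw [hdiff, abs_neg, abs_of_nonneg (by positivity), hwx i, hwx k, hi, ← add_one_mul,
      mul_div_mul_right _ _ hk.ne']
  have pair : ∀ i ∈ Finset.univ.erase j,
      Real.exp (-(2 * √(2 / τ) * (1 / √(Nat.dist i j : ℝ)))) ≤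
        ‖(w j - w i) / (1 - (starRingEnd ℂ) (w i) * w j)‖ := by
    intro i hi
    have hij : (i : ℕ) ≠ j := fun h => (Finset.mem_erase.1 hi).1 (Fin.ext h)
    have hA : Real.exp (-(2 * √(2 / (Nat.dist i j * τ)))) ≤
        |‖w i‖ - ‖w j‖| / ((1 - ‖w i‖) + (1 - ‖w j‖)) := by
      rcases lt_or_gt_of_ne hij with h | h
      · rw [Nat.dist_eq_sub_of_le h.le]
        exact pair_lt i j h
      · rw [Nat.dist_eq_sub_of_le_right h.le, abs_sub_comm, add_comm (1 - ‖w i‖)]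
        exact pair_lt j i h
    have hsq : 2 * √(2 / τ) * (1 / √(Nat.dist i j : ℝ)) = 2 * √(2 / (Nat.dist i j * τ)) := by
      rw [mul_assoc, ← Real.sqrt_one, ← Real.sqrt_div zero_le_one,
        ← Real.sqrt_mul (by positivity)]
      congr 2
      rw [div_mul_div_comm, mul_one, mul_comm τ]
    rw [hsq]
    refine hA.trans ?_
    have hden : 0 < ‖1 - (starRingEnd ℂ) (w i) * w j‖ := by
      rw [norm_pos_iff]
      intro h
      have h2 : ‖(starRingEnd ℂ) (w i) * w j‖ = 1 := by
        rw [← sub_eq_zero.1 h, norm_one]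
      rw [norm_mul, RCLike.norm_conj] at h2
      nlinarith [norm_nonneg (w i), norm_nonneg (w j), hw i, hw j]
    rw [norm_div, div_le_div_iff₀ (by linarith [hw i, hw j]) hden]
    exact abs_sub_mul_norm_le (w i) (w j) (hw i) (hw j)
  rw [norm_prod]
  refine le_trans ?_ (Finset.prod_le_prod (fun _ _ => (Real.exp_pos _).le) pair)
  rw [← Real.exp_sum, Real.exp_le_exp, Finset.sum_neg_distrib, ← Finset.mul_sum]
  have hg : ∀ k : ℕ, (0 : ℝ) ≤ 1 / √(k : ℝ) := fun k => by positivity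
  have hsum : ∑ i ∈ Finset.univ.erase j, 1 / √(Nat.dist i j : ℝ) ≤ 4 * √(n : ℝ) := by
    calc _ ≤ ∑ i : Fin n, 1 / √(Nat.dist i j : ℝ) :=
          Finset.sum_le_sum_of_subset_of_nonneg (Finset.erase_subset _ _) fun _ _ _ => hg _
      _ = ∑ i ∈ Finset.range n, 1 / √(Nat.dist i j : ℝ) :=
          Fin.sum_univ_eq_sum_range (fun i : ℕ => 1 / √(Nat.dist i j : ℝ)) n
      _ ≤ 2 * ∑ k ∈ Finset.range n, 1 / √(k : ℝ) :=
          sum_dist_le_two_mul_sum (g := fun k : ℕ => 1 / √(k : ℝ)) hg j.2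
      _ ≤ 2 * ∑ k ∈ Finset.range (n + 1), 1 / √(k : ℝ) := by
          rw [Finset.sum_range_succ]
          linarith [hg n]
      _ ≤ _ := by linarith [sum_one_div_sqrt_le n]
  have h0 : 0 ≤ √(2 / τ) := Real.sqrt_nonneg _
  nlinarith [mul_le_mul_of_nonneg_left hsum h0]

/-- Lower bound for approximation numbers of a composition operator by Blaschke interpolation. -/
lemma le_approxNum_of_blaschke {φ : ℂ → ℂ} (hφ : Set.MapsTo φ unitDisk unitDisk)
    {T : H2 →L[ℂ] H2} (hT : IsCompOp φ T) {n : ℕ} (hn : 1 ≤ n) {r p : ℝ} (hr : r < 1)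
    (u : Fin n → ℂ) (hu : ∀ i, ‖u i‖ ≤ r)
    (hp : ∀ j, p ≤ ‖∏ i ∈ Finset.univ.erase j,
      (φ (u j) - φ (u i)) / (1 - (starRingEnd ℂ) (φ (u i)) * φ (u j))‖) :
    (1 - r) * p / n ≤ approxNum n T := by
  have hnpos : (0 : ℝ) < n := by exact_mod_cast hn
  have hu1 : ∀ i, u i ∈ unitDisk := fun i => by
    simpa [unitDisk] using (hu i).trans_lt hr
  have hw : ∀ i, ‖φ (u i)‖ < 1 := fun i => by simpa [unitDisk] using hφ (hu1 i)
  choose B hB hBz using fun j : Fin n =>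
    H2.exists_blaschke_prod (Finset.univ.erase j) (fun i => φ (u i)) hw
  refine le_csInf ⟨_, 0, ?_, rfl⟩ ?_
  · have : LinearMap.range ((0 : H2 →L[ℂ] H2) : H2 →ₗ[ℂ] H2) = ⊥ := by simp
    rw [this, rank_bot]
    exact_mod_cast hn
  · rintro _ ⟨R, hR, rfl⟩
    let E : (Fin n → ℂ) →ₗ[ℂ] H2 := Fintype.linearCombination ℂ B
    obtain ⟨c, hc, hc0⟩ : ∃ c : Fin n → ℂ, R (E c) = 0 ∧ c ≠ 0 := by
      by_contra! hcon
      have hinj : Function.Injective ((R : H2 →ₗ[ℂ] H2) ∘ₗ E) :=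
        (injective_iff_map_eq_zero _).2 hcon
      have h1 := rank_range_of_injective _ hinj
      have h2 : Module.rank ℂ (LinearMap.range ((R : H2 →ₗ[ℂ] H2) ∘ₗ E)) ≤
          Module.rank ℂ (LinearMap.range (R : H2 →ₗ[ℂ] H2)) :=
        Submodule.rank_mono (LinearMap.range_comp_le_range _ _)
      rw [h1] at h2
      have h3 : Module.rank ℂ (Fin n → ℂ) = n := by simp
      rw [h3] at h2
      exact absurd hR (not_lt.2 h2)
    have : Nonempty (Fin n) := ⟨⟨0, hn⟩⟩
    obtain ⟨j, hj⟩ := Finite.exists_max fun i => ‖c i‖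
    have hcj : 0 < ‖c j‖ := by
      obtain ⟨i, hi⟩ := Function.ne_iff.1 hc0
      exact (norm_pos_iff.2 hi).trans_le (hj i)
    have hE : E c = ∑ i, c i • B i := Fintype.linearCombination_apply ℂ B c
    have hEn : ‖E c‖ ≤ n * ‖c j‖ := by
      rw [hE]
      calc _ ≤ ∑ _i : Fin n, ‖c j‖ := norm_sum_le_of_le _ fun i _ => by
            rw [norm_smul]
            nlinarith [hj i, hB i, norm_nonneg (c i), norm_nonneg (B i)]
        _ = _ := by simp
    have hTn : ‖T (E c)‖ ≤ ‖T - R‖ * ‖E c‖ := by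
      have := (T - R).le_opNorm (E c)
      rwa [sub_apply, hc, sub_zero] at this
    have hev : H2.eval (T (E c)) (u j) = c j * H2.eval (B j) (φ (u j)) := by
      rw [hT _ _ (hu1 j), hE]
      change H2.evalLM_s3 (φ (u j)) (hw j) _ = _
      rw [map_sum, Finset.sum_eq_single j]
      · rw [map_smul]
        rfl
      · intro i _ hij
        rw [map_smul]
        change c i • H2.eval (B i) (φ (u j)) = 0
        rw [hBz i _ (hw j), Finset.prod_eq_zero (Finset.mem_erase.2 ⟨hij.symm, Finset.mem_univ j⟩)
          (by simp), smul_zero]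
      · simp
    have h1r : 0 < 1 - r := by linarith
    have hlow : ‖c j‖ * p ≤ ‖T (E c)‖ / (1 - r) := by
      calc _ ≤ ‖c j‖ * ‖H2.eval (B j) (φ (u j))‖ := by
            rw [hBz j _ (hw j)]
            exact mul_le_mul_of_nonneg_left (hp j) hcj.le
        _ = ‖H2.eval (T (E c)) (u j)‖ := by rw [hev, norm_mul]
        _ ≤ ‖T (E c)‖ / (1 - ‖u j‖) := H2.norm_eval_le_s3 _ ((hu j).trans_lt hr)
        _ ≤ _ := by
            have := hu j
            gcongr
    rw [le_div_iff₀ h1r] at hlow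
    rw [div_le_iff₀ hnpos]
    have : ‖T - R‖ * ‖E c‖ ≤ ‖T - R‖ * (n * ‖c j‖) := by gcongr
    refine le_of_mul_le_mul_right ?_ hcj
    linarith

/-- If `‖φ‖_∞ = 1`, then `1 - |φ|` takes all small values, uniformly inside the disk. -/
lemma exists_forall_one_sub_norm_eq {φ : ℂ → ℂ} (hφ : ContinuousOn φ unitDisk)
    (hsup : sSup ((fun z => ‖φ z‖) '' unitDisk) = 1) {s : ℝ} (hs : 0 < s) :
    ∃ r < 1, ∀ y, s ≤ y → y ≤ 1 - ‖φ 0‖ → ∃ u : ℂ, ‖u‖ ≤ r ∧ 1 - ‖φ u‖ = y := by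
  have h0 : (0 : ℂ) ∈ unitDisk := by simp [unitDisk]
  obtain ⟨_, ⟨z, hz, rfl⟩, hlt⟩ := exists_lt_of_lt_csSup (s := (fun z => ‖φ z‖) '' unitDisk)
    ⟨_, 0, h0, rfl⟩ (b := 1 - s) (by linarith)
  have hz1 : ‖z‖ < 1 := by simpa [unitDisk] using hz
  have hle : ∀ t ∈ Set.Icc (0 : ℝ) 1, ‖(t : ℂ) * z‖ ≤ ‖z‖ := by
    intro t ht
    rw [norm_mul, Complex.norm_real, Real.norm_of_nonneg ht.1]
    exact mul_le_of_le_one_left (norm_nonneg z) ht.2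
  have hcont : ContinuousOn (fun t : ℝ => ‖φ (t * z)‖) (Set.Icc 0 1) := by
    refine (hφ.comp (by fun_prop) fun t ht => ?_).norm
    simpa [unitDisk] using (hle t ht).trans_lt hz1
  refine ⟨‖z‖, hz1, fun y hy hy' => ?_⟩
  obtain ⟨t, ht, hty⟩ := intermediate_value_Icc zero_le_one hcont
    (show 1 - y ∈ Set.Icc _ _ from by
      constructor
      · simp only [Complex.ofReal_zero, zero_mul]
        linarith
      · simp only [Complex.ofReal_one, one_mul]
        linarith)
  exact ⟨t * z, hle t ht, by simp only at hty; linarith⟩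

lemma exists_mul_exp_le_approxNum {φ : ℂ → ℂ} (hφ : IsSymbol φ)
    (hsup : sSup ((fun z => ‖φ z‖) '' unitDisk) = 1) {T : H2 →L[ℂ] H2} (hT : IsCompOp φ T)
    {η : ℝ} (hη : 0 < η) :
    ∃ c > (0 : ℝ), ∀ n : ℕ, 1 ≤ n → c * Real.exp (-(2 * η * n)) ≤ approxNum n T := by
  set x₀ : ℝ := 1 - ‖φ 0‖ with hx₀
  have hx₀pos : 0 < x₀ := by
    have h : φ 0 ∈ unitDisk := hφ.mapsTo (by simp [unitDisk])
    have : ‖φ 0‖ < 1 := by simpa [unitDisk] using h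
    linarith
  set L : ℝ := 2 * (8 / η) ^ 2 with hL
  have hLpos : 0 < L := by positivity
  obtain ⟨r, hr, hval⟩ := exists_forall_one_sub_norm_eq hφ.diff.continuousOn hsup
    (show 0 < x₀ / Real.exp L by positivity)
  have h1r : 0 < 1 - r := by linarith
  refine ⟨(1 - r) * η, by positivity, fun n hn => ?_⟩
  have hnpos : (0 : ℝ) < n := by exact_mod_cast hn
  set τ : ℝ := L / n with hτ
  have hτpos : 0 < τ := by positivity
  have hpt : ∀ i : Fin n, ∃ u : ℂ, ‖u‖ ≤ r ∧ 1 - ‖φ u‖ = x₀ / (1 + τ) ^ (i : ℕ) := by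
    intro i
    refine hval _ ?_ (div_le_self hx₀pos.le (one_le_pow₀ (by linarith)))
    gcongr
    calc (1 + τ) ^ (i : ℕ) ≤ (1 + τ) ^ n := pow_le_pow_right₀ (by linarith) i.2.le
      _ ≤ Real.exp τ ^ n := by
          gcongr
          linarith [Real.add_one_le_exp τ]
      _ = Real.exp L := by
          rw [← Real.exp_nat_mul, hτ]
          congr 1
          field_simp
  choose u hu hux using hpt
  have hw : ∀ i, ‖φ (u i)‖ < 1 := fun i => by
    have : 0 < x₀ / (1 + τ) ^ (i : ℕ) := by positivity
    linarith [hux i]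
  have hp := exp_le_prod_norm_blaschke hτpos hx₀pos (fun i => φ (u i)) hw hux
  refine le_trans ?_ (le_approxNum_of_blaschke hφ.mapsTo hT hn hr u hu hp)
  have hexp : 8 * √(2 / τ) * √(n : ℝ) = η * n := by
    rw [mul_assoc, ← Real.sqrt_mul (by positivity)]
    have : 2 / τ * n = (η * n / 8) ^ 2 := by
      rw [hτ, hL]
      field_simp
    rw [this, Real.sqrt_sq (by positivity)]
    ring
  rw [hexp, mul_assoc, mul_div_assoc]
  refine mul_le_mul_of_nonneg_left ?_ h1r.le
  rw [le_div_iff₀ hnpos]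
  have hsplit : Real.exp (-(2 * η * n)) = Real.exp (-(η * n)) * Real.exp (-(η * n)) := by
    rw [← Real.exp_add]
    congr 1
    ring
  have hbd : η * n * Real.exp (-(η * n)) ≤ 1 := by
    rw [Real.exp_neg, ← div_eq_mul_inv, div_le_one (Real.exp_pos _)]
    linarith [Real.add_one_le_exp (η * n)]
  rw [hsplit]
  nlinarith [Real.exp_pos (-(η * n))]

/-- A sequence dominating every decaying exponential, up to a constant, decays
subexponentially. -/
lemma exists_subexponential_lower_bound {a : ℕ → ℝ}
    (h : ∀ η > (0 : ℝ), ∃ c > (0 : ℝ), ∀ n : ℕ, 1 ≤ n → c * Real.exp (-(2 * η * n)) ≤ a n) :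
    ∃ ε : ℕ → ℝ, (∀ n, 0 < ε n) ∧ Filter.Tendsto ε Filter.atTop (nhds 0) ∧
      ∀ n : ℕ, 1 ≤ n → Real.exp (-(n : ℝ) * ε n) ≤ a n := by
  have hnn : ∀ n : ℕ, (0 : ℝ) < 1 / ((n : ℝ) + 1) := fun n => by positivity
  have hmax : Filter.Tendsto (fun n : ℕ => max 0 (-Real.log (a n) / n)) Filter.atTop (nhds 0) := by
    refine tendsto_order.2 ⟨fun b hb => Filter.Eventually.of_forall fun n =>
      hb.trans_le (le_max_left _ _), fun b hb => ?_⟩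
    obtain ⟨c, hc, hca⟩ := h (b / 4) (by positivity)
    have hlim : Filter.Tendsto (fun n : ℕ => -Real.log c / (n : ℝ)) Filter.atTop (nhds 0) :=
      tendsto_const_div_atTop_nhds_zero_nat _
    filter_upwards [hlim.eventually_lt_const (show (0 : ℝ) < b / 2 by positivity),
      Filter.eventually_ge_atTop 1] with n hn hn1
    have hnpos : (0 : ℝ) < n := by exact_mod_cast hn1
    refine max_lt hb ?_
    have hlog := Real.log_le_log (by positivity) (hca n hn1)
    rw [Real.log_mul hc.ne' (Real.exp_pos _).ne', Real.log_exp] at hlog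
    rw [div_lt_iff₀ hnpos] at hn ⊢
    linarith
  refine ⟨fun n => max 0 (-Real.log (a n) / n) + 1 / ((n : ℝ) + 1), fun n => ?_, ?_, fun n hn => ?_⟩
  · exact add_pos_of_nonneg_of_pos (le_max_left _ _) (hnn n)
  · simpa using hmax.add tendsto_one_div_add_atTop_nhds_zero_nat
  · have hnpos : (0 : ℝ) < n := by exact_mod_cast hn
    obtain ⟨c, hc, hca⟩ := h 1 one_pos
    have hapos : 0 < a n := lt_of_lt_of_le (by positivity) (hca n hn)
    rw [← Real.le_log_iff_exp_le hapos]
    have h1 : -Real.log (a n) / n ≤ max 0 (-Real.log (a n) / n) + 1 / ((n : ℝ) + 1) :=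
      (le_max_right _ _).trans (le_add_of_nonneg_right (hnn n).le)
    rw [div_le_iff₀ hnpos] at h1
    linarith

/-- if `‖φ‖_∞ = 1`, there are `δ > 0` and positive `ε_n → 0` with
`a_n(C_φ) ≥ δ e^{-n ε_n}` for all `n ≥ 1`. -/
theorem stmt_3 (φ : ℂ → ℂ) (hφ : IsSymbol φ)
    (hsup : sSup ((fun z => ‖φ z‖) '' unitDisk) = 1)
    (T : H2 →L[ℂ] H2) (hT : IsCompOp φ T) :
    ∃ δ > (0 : ℝ), ∃ ε : ℕ → ℝ, (∀ n, 0 < ε n) ∧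
      Filter.Tendsto ε Filter.atTop (nhds 0) ∧
      ∀ n : ℕ, 1 ≤ n → δ * Real.exp (-(n : ℝ) * ε n) ≤ approxNum n T := by
  obtain ⟨ε, hpos, hlim, hle⟩ := exists_subexponential_lower_bound
    fun η hη => exists_mul_exp_le_approxNum hφ hsup hT hη
  exact ⟨1, one_pos, ε, hpos, hlim, fun n hn => by simpa only [one_mul] using hle n hn⟩

end
end
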